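/- arXiv:1711.04871 — 3 statements merged into one kernel-verified Lean document; each statement's English description precedes it below -/
import Mathlib

section
/- Let R be a Noetherian commutative ring of Krull dimension d, and let P, Q be finitely generated projective R-modules of constant rank greater than d. If P and Q are stably isomorphic (i.e., P ⊕ R^n ≅ Q ⊕ R^m for some n, m with equal total ranks), then P ≅ Q. -/
/-- `M` has constant rank `r`: its localization at every prime of `R` is a
free module of rank `r`. -/
def HasConstantRank (R : Type*) [CommRing R] (M : Type*) [AddCommGroup M] [Module R M]
    (r : ℕ) : Prop :=
  ∀ p : PrimeSpectrum R,
    Module.Free (Localization.AtPrime p.asIdeal) (LocalizedModule p.asIdeal.primeCompl M) ∧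
    Module.finrank (Localization.AtPrime p.asIdeal) (LocalizedModule p.asIdeal.primeCompl M) = r

namespace BassCancel

/-- Reduction of a vector modulo a prime. -/
noncomputable def red {R κ : Type} [CommRing R] (P : PrimeSpectrum R) :
    (κ → R) →ₗ[R] (κ → P.asIdeal.ResidueField) :=
  LinearMap.pi fun j => (Algebra.linearMap R P.asIdeal.ResidueField) ∘ₗ LinearMap.proj j

lemma red_apply {R κ : Type} [CommRing R] (P : PrimeSpectrum R) (x : κ → R) (j : κ) :
    red P x j = algebraMap R P.asIdeal.ResidueField (x j) := rfl

lemma red_eq_zero {R κ : Type} [CommRing R] (P : PrimeSpectrum R) (x : κ → R) :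
    red P x = 0 ↔ ∀ j, x j ∈ P.asIdeal := by
  simp [funext_iff, red_apply, Ideal.algebraMap_residueField_eq_zero]

/-- The rank modulo `P` of a set of vectors. -/
noncomputable def rk {R κ : Type} [CommRing R] (P : PrimeSpectrum R) (S : Set (κ → R)) : ℕ :=
  Module.finrank P.asIdeal.ResidueField
    (Submodule.span P.asIdeal.ResidueField (red P '' S))

/-- Simultaneous avoidance for affine functions and finitely many primes. -/
lemma avoid {R ι : Type} [CommRing R] [Fintype ι] (k : ℕ) :
    ∀ (F : Finset (PrimeSpectrum R)), F.card = k →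
    ∀ (μ : PrimeSpectrum R → R) (l : PrimeSpectrum R → ι → R),
    (∀ P ∈ F, μ P ∉ P.asIdeal ∨ ∃ i, l P i ∉ P.asIdeal) →
    ∃ c : ι → R, ∀ P ∈ F, μ P + ∑ i, l P i * c i ∉ P.asIdeal := by
  classical
  induction k with
  | zero =>
    intro F hF μ l h
    rw [Finset.card_eq_zero] at hF
    subst hF
    exact ⟨0, by simp⟩
  | succ k ih =>
    intro F hF μ l h
    obtain ⟨P, hP⟩ := F.exists_minimal (Finset.card_pos.mp (by omega))
    have hPF : P ∈ F := hP.1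
    obtain ⟨c, hc⟩ := ih (F.erase P) (by rw [Finset.card_erase_of_mem hPF]; omega) μ l
      (fun Q hQ => h Q (Finset.mem_of_mem_erase hQ))
    by_cases hg : μ P + ∑ i, l P i * c i ∈ P.asIdeal
    swap
    · refine ⟨c, fun Q hQ => ?_⟩
      by_cases hQP : Q = P
      · subst hQP; exact hg
      · exact hc Q (Finset.mem_erase.mpr ⟨hQP, hQ⟩)
    · have : ∃ i, l P i ∉ P.asIdeal := by
        by_contra hcon
        push Not at hcon
        have hμ : μ P ∉ P.asIdeal := by
          rcases h P hPF with h | ⟨i, hi⟩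
          · exact h
          · exact absurd (hcon i) hi
        apply hμ
        exact (Ideal.add_mem_iff_left _
          (Ideal.sum_mem _ fun i _ => Ideal.mul_mem_right _ _ (hcon i))).mp hg
      obtain ⟨i, hi⟩ := this
      have ht : ∃ t : R, (∀ Q ∈ F.erase P, t ∈ Q.asIdeal) ∧ t ∉ P.asIdeal := by
        have h1 : ∀ Q ∈ F.erase P, ∃ t ∈ Q.asIdeal, t ∉ P.asIdeal := by
          intro Q hQ
          by_contra hcon
          push Not at hcon
          have hQP : Q ≤ P := hcon
          exact Finset.ne_of_mem_erase hQ
            (le_antisymm hQP (hP.2 (Finset.mem_of_mem_erase hQ) hQP))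
        choose! t ht1 ht2 using h1
        refine ⟨∏ Q ∈ F.erase P, t Q, fun Q hQ => ?_, ?_⟩
        · exact Ideal.mem_of_dvd _ (Finset.dvd_prod_of_mem t hQ) (ht1 Q hQ)
        · rw [P.2.prod_mem_iff]
          rintro ⟨Q, hQ, h⟩
          exact ht2 Q hQ h
      obtain ⟨t, ht1, ht2⟩ := ht
      refine ⟨c + Pi.single i t, fun Q hQ => ?_⟩
      have key : μ Q + ∑ j, l Q j * (c + Pi.single i t : ι → R) j
          = (μ Q + ∑ j, l Q j * c j) + l Q i * t := by
        simp [mul_add, Finset.sum_add_distrib, add_assoc, Pi.single_apply]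
      rw [key]
      by_cases hQP : Q = P
      · subst hQP
        rw [Ideal.add_mem_iff_right _ hg]
        intro hm
        rcases Q.2.mem_or_mem hm with h | h
        · exact hi h
        · exact ht2 h
      · have hQe := Finset.mem_erase.mpr ⟨hQP, hQ⟩
        rw [Ideal.add_mem_iff_left _ (Ideal.mul_mem_left _ _ (ht1 Q hQe))]
        exact hc Q hQe

/-- Linear independence mod `P` comes from a minor. -/
lemma exists_minor {R κ : Type} [CommRing R] [Fintype κ] (P : PrimeSpectrum R) {s : ℕ}
    (w : Fin s → κ → R)
    (h : LinearIndependent P.asIdeal.ResidueField (fun i => red P (w i))) :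
    ∃ f : Fin s → κ, (Matrix.of fun i j => w i (f j)).det ∉ P.asIdeal := by
  classical
  let K := P.asIdeal.ResidueField
  let A : Matrix (Fin s) κ K := Matrix.of fun i => red P (w i)
  have hA : A.rank = s := by
    have : LinearIndependent K A.row := h
    simpa using this.rank_matrix
  have hc : Module.finrank K (Submodule.span K (Set.range A.col)) = s := by
    rw [← A.rank_eq_finrank_span_cols, hA]
  have hex := Submodule.exists_fun_fin_finrank_span_eq K (Set.range A.col)
  rw [hc] at hex
  obtain ⟨g, hg1, -, hg3⟩ := hex
  choose f hf using hg1
  refine ⟨f, fun hmem => ?_⟩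
  have hu : IsUnit (A.submatrix id f) := by
    rw [← Matrix.linearIndependent_cols_iff_isUnit]
    have : (A.submatrix id f).col = g := by
      funext j
      rw [← hf j]
      rfl
    rw [this]
    exact hg3
  rw [Matrix.isUnit_iff_isUnit_det] at hu
  apply hu.ne_zero
  have : A.submatrix id f
      = (algebraMap R K).mapMatrix (Matrix.of fun i j => w i (f j)) := by
    ext i j
    rfl
  rw [this, ← RingHom.map_det]
  exact Ideal.algebraMap_residueField_eq_zero.mpr hmem

lemma indep_of_minor {R κ : Type} [CommRing R] [Fintype κ] (P : PrimeSpectrum R) {s : ℕ}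
    (w : Fin s → κ → R) (f : Fin s → κ)
    (h : (Matrix.of fun i j => w i (f j)).det ∉ P.asIdeal) :
    LinearIndependent P.asIdeal.ResidueField (fun i => red P (w i)) := by
  classical
  let K := P.asIdeal.ResidueField
  have h1 : ((algebraMap R K).mapMatrix (Matrix.of fun i j => w i (f j))).det ≠ 0 := by
    rw [← RingHom.map_det]
    exact fun h0 => h (Ideal.algebraMap_residueField_eq_zero.mp h0)
  have h2 := Matrix.linearIndependent_rows_of_det_ne_zero h1
  have h3 : LinearIndependent K (fun i => LinearMap.funLeft K K f (red P (w i))) := h2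
  exact LinearIndependent.of_comp (LinearMap.funLeft K K f) h3

lemma isOpen_rk {R κ : Type} [CommRing R] [Fintype κ] (S : Set (κ → R)) (t : ℕ) :
    IsOpen {P : PrimeSpectrum R | t < rk P S} := by
  rw [isOpen_iff_forall_mem_open]
  intro P hP
  obtain ⟨g, hg1, -, hg3⟩ :=
    Submodule.exists_fun_fin_finrank_span_eq P.asIdeal.ResidueField (red P '' S)
  choose w hw hwg using hg1
  have : g = fun i => red P (w i) := funext fun i => (hwg i).symm
  rw [this] at hg3
  obtain ⟨f, hf⟩ := exists_minor P w hg3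
  refine ⟨PrimeSpectrum.basicOpen (Matrix.of fun i j => w i (f j)).det, ?_,
    (PrimeSpectrum.basicOpen _).isOpen, hf⟩
  intro Q hQ
  have h1 := indep_of_minor Q w f hQ
  have h2 := finrank_span_eq_card h1
  rw [Fintype.card_fin] at h2
  change t < _
  refine lt_of_lt_of_le (show t < rk P S from hP) ?_
  change Module.finrank _ _ ≤ _
  rw [← h2]
  refine Submodule.finrank_mono (Submodule.span_mono ?_)
  rintro _ ⟨i, rfl⟩
  exact ⟨w i, hw i, rfl⟩

/-- Dependence mod `P` in terms of ring elements. -/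
lemma exists_dep {R ι κ : Type} [CommRing R] [Fintype ι] [Fintype κ] (P : PrimeSpectrum R)
    (y : ι → κ → R) (v : κ → R)
    (h : rk P (insert v (Set.range y)) ≤ Fintype.card ι) :
    ∃ (μ : R) (l : ι → R), (μ ∉ P.asIdeal ∨ ∃ i, l i ∉ P.asIdeal) ∧
      red P (μ • v + ∑ i, l i • y i) = 0 := by
  classical
  let K := P.asIdeal.ResidueField
  let z : Option ι → κ → R := fun o => o.elim v y
  have hz : Set.range (fun o => red P (z o)) = red P '' (insert v (Set.range y)) := by
    ext u
    simp [z, Option.exists, eq_comm]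
  have hdep : ¬ LinearIndependent K (fun o => red P (z o)) := by
    intro hli
    have := finrank_span_eq_card hli
    rw [hz] at this
    unfold rk at h
    rw [this] at h
    simp at h
  rw [← LinearIndependent.iff_fractionRing (R ⧸ P.asIdeal) K, Fintype.not_linearIndependent_iff]
    at hdep
  obtain ⟨g, hg, o, ho⟩ := hdep
  choose c hc using fun o => Ideal.Quotient.mk_surjective (g o)
  refine ⟨c none, fun i => c (some i), ?_, ?_⟩
  · have : c o ∉ P.asIdeal := fun h => ho (by
      rw [← hc, Ideal.Quotient.eq_zero_iff_mem]; exact h)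
    cases o with
    | none => exact Or.inl this
    | some i => exact Or.inr ⟨i, this⟩
  · rw [← hg, Fintype.sum_option, map_add, map_sum]
    have hs : ∀ (r : R) (x : κ → K), Ideal.Quotient.mk P.asIdeal r • x = r • x :=
      fun r x => algebraMap_smul (R ⧸ P.asIdeal) r x
    simp only [← hc, map_smul, hs]
    rfl

/-- Finiteness of the set of critical primes. -/
lemma finite_crit {R κ : Type} [CommRing R] [IsNoetherianRing R] [Fintype κ]
    (a : R) (S : Set (κ → R)) (n : ℕ)
    (H : ∀ P : PrimeSpectrum R, a ∉ P.asIdeal → n + 1 ≤ rk P S ∨ Order.coheight P < rk P S) :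
    {P : PrimeSpectrum R | a ∉ P.asIdeal ∧ rk P S ≤ n ∧ Order.coheight P + 1 = rk P S}.Finite := by
  have hcl : ∀ t : ℕ, ∃ I : Ideal R, {P : PrimeSpectrum R | rk P S ≤ t}
      = PrimeSpectrum.zeroLocus (I : Set R) := by
    intro t
    rw [← PrimeSpectrum.isClosed_iff_zeroLocus_ideal]
    have : {P : PrimeSpectrum R | rk P S ≤ t} = {P : PrimeSpectrum R | t < rk P S}ᶜ := by
      ext P; simp
    rw [this]
    exact (isOpen_rk S t).isClosed_compl
  choose I hI using hcl
  have hfin : (⋃ t ∈ Finset.range (n + 1),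
      (PrimeSpectrum.asIdeal) ⁻¹' ((I t).minimalPrimes)).Finite := by
    refine Set.Finite.biUnion (Finset.finite_toSet _) fun t _ => ?_
    exact ((I t).finite_minimalPrimes_of_isNoetherianRing R).preimage
      (fun P _ Q _ h => PrimeSpectrum.ext h)
  refine hfin.subset ?_
  rintro P ⟨ha, hn, hc⟩
  simp only [Set.mem_iUnion]
  refine ⟨rk P S, Finset.mem_range.mpr (by omega), ?_⟩
  have hP : P ∈ PrimeSpectrum.zeroLocus (I (rk P S) : Set R) := by
    rw [← hI]; exact le_refl (rk P S)
  obtain ⟨q, hq, hqP⟩ := Ideal.exists_minimalPrimes_le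
    (show I (rk P S) ≤ P.asIdeal from hP)
  let Q : PrimeSpectrum R := ⟨q, hq.1.1⟩
  have hQP : Q ≤ P := hqP
  have hQ : rk Q S ≤ rk P S := by
    have : Q ∈ PrimeSpectrum.zeroLocus (I (rk P S) : Set R) := hq.1.2
    rw [← hI] at this
    exact this
  rcases eq_or_lt_of_le hQP with h | h
  · have h' : Q.asIdeal = P.asIdeal := by rw [h]
    change P.asIdeal ∈ (I (rk P S)).minimalPrimes
    rw [← h']; exact hq
  · exfalso
    rcases H Q (fun h => ha (hqP h)) with h1 | h1
    · omega
    · have h2 := Order.coheight_add_one_le h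
      rw [hc] at h2
      have h3 := lt_of_le_of_lt h2 h1
      have h4 : rk P S < rk Q S := by exact_mod_cast h3
      omega

/-- One reduction step. -/
lemma step {R ι κ : Type} [CommRing R] [IsNoetherianRing R] [Fintype ι] [Fintype κ]
    (a : R) (y : ι → κ → R) (v : κ → R) (b : ι → R)
    (hb : ∀ (P : PrimeSpectrum R) i, a ∉ P.asIdeal → b i ∉ P.asIdeal)
    (H : ∀ P : PrimeSpectrum R, a ∉ P.asIdeal →
      Fintype.card ι + 1 ≤ rk P (insert v (Set.range y)) ∨
        Order.coheight P < rk P (insert v (Set.range y))) :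
    ∃ c : ι → R, ∀ P : PrimeSpectrum R, a ∉ P.asIdeal →
      Fintype.card ι ≤ rk P (Set.range fun i => y i + (b i * c i) • v) ∨
        Order.coheight P < rk P (Set.range fun i => y i + (b i * c i) • v) := by
  classical
  have hfin := finite_crit a (insert v (Set.range y)) (Fintype.card ι) H
  have hdep := fun P : PrimeSpectrum R => exists_dep P y v
  choose! μ l hl1 hl2 using hdep
  obtain ⟨c, hc⟩ := avoid (ι := ι) _ hfin.toFinset rfl μ (fun P i => - (l P i * b i)) (by
    intro P hP
    rw [Set.Finite.mem_toFinset] at hP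
    obtain ⟨ha, hn, -⟩ := hP
    rcases hl1 P hn with h | ⟨i, hi⟩
    · exact Or.inl h
    · refine Or.inr ⟨i, fun hm => ?_⟩
      rw [neg_mem_iff] at hm
      rcases P.2.mem_or_mem hm with h | h
      · exact hi h
      · exact hb P i ha h)
  refine ⟨c, fun P ha => ?_⟩
  set y' : ι → κ → R := fun i => y i + (b i * c i) • v with hy'
  let K := P.asIdeal.ResidueField
  let V := Submodule.span K (red P '' (insert v (Set.range y)))
  let V' := Submodule.span K (red P '' (Set.range y'))
  have hVle : V ≤ V' ⊔ Submodule.span K {red P v} := by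
    refine Submodule.span_le.mpr ?_
    have hv : red P v ∈ V' ⊔ Submodule.span K {red P v} :=
      Submodule.mem_sup_right (Submodule.mem_span_singleton_self _)
    rintro _ ⟨x, hx | ⟨i, rfl⟩, rfl⟩
    · rw [hx]; exact hv
    · have : red P (y i) = red P (y' i) - (algebraMap R K (b i * c i)) • red P v := by
        simp only [hy', map_add, map_smul, algebraMap_smul]
        abel
      rw [SetLike.mem_coe, this]
      exact Submodule.sub_mem _ (Submodule.mem_sup_left
        (Submodule.subset_span ⟨_, ⟨i, rfl⟩, rfl⟩)) (Submodule.smul_mem _ _ hv)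
  have hle : rk P (insert v (Set.range y)) ≤ rk P (Set.range y') + 1 := by
    calc _ ≤ Module.finrank K ↥(V' ⊔ Submodule.span K {red P v}) := Submodule.finrank_mono hVle
      _ ≤ Module.finrank K V' + Module.finrank K (Submodule.span K {red P v}) :=
        Submodule.finrank_add_le_finrank_add_finrank _ _
      _ ≤ _ := Nat.add_le_add_left (by
        simpa using finrank_span_le_card (R := K) ({red P v} : Set (κ → K))) _
  by_cases hn : rk P (insert v (Set.range y)) ≤ Fintype.card ι
  swap
  · left; omega
  right
  have hco : Order.coheight P < rk P (insert v (Set.range y)) := by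
    rcases H P ha with h | h
    · omega
    · exact h
  rcases eq_or_lt_of_le (Order.add_one_le_of_lt hco) with h | h
  · have hcP := hc P (by rw [Set.Finite.mem_toFinset]; exact ⟨ha, hn, h⟩)
    set m := μ P + ∑ i, -(l P i * b i) * c i with hm
    have hmv : m • v = (μ P • v + ∑ i, l P i • y i) - ∑ i, l P i • y' i := by
      simp only [hm, hy', smul_add, Finset.sum_add_distrib, add_smul, Finset.sum_smul, smul_smul]
      simp only [neg_mul, neg_smul, Finset.sum_neg_distrib, mul_assoc]
      abel
    have hvV : red P v ∈ V' := by
      have h1 : (algebraMap R K m) • red P v ∈ V' := by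
        rw [algebraMap_smul, ← map_smul, hmv, map_sub, hl2 P hn, zero_sub, map_sum]
        refine Submodule.neg_mem _ (Submodule.sum_mem _ fun i _ => ?_)
        rw [map_smul, ← algebraMap_smul K]
        exact Submodule.smul_mem _ _ (Submodule.subset_span ⟨_, ⟨i, rfl⟩, rfl⟩)
      exact (Submodule.smul_mem_iff _
        (fun h0 => hcP (Ideal.algebraMap_residueField_eq_zero.mp h0))).mp h1
    have hVV : V ≤ V' := hVle.trans (sup_le le_rfl (by
      rw [Submodule.span_singleton_le_iff_mem]; exact hvV))
    have : rk P (insert v (Set.range y)) ≤ rk P (Set.range y') := Submodule.finrank_mono hVV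
    exact lt_of_lt_of_le hco (by exact_mod_cast this)
  · have h5 : (rk P (insert v (Set.range y)) : ℕ∞) ≤ rk P (Set.range y') + 1 := by
      exact_mod_cast hle
    have h6 := lt_of_lt_of_le h h5
    exact lt_of_add_lt_add_right h6

lemma main_vec {R κ : Type} [CommRing R] [IsNoetherianRing R] [Fintype κ] (a : R) (n : ℕ) :
    ∀ (p : κ → R) (x : Fin n → κ → R),
    (∀ P : PrimeSpectrum R, a ∉ P.asIdeal →
      n + 1 ≤ rk P (insert p (Set.range x)) ∨
        Order.coheight P < rk P (insert p (Set.range x))) →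
    ∃ q ∈ Submodule.span R (Set.range x), ∀ P : PrimeSpectrum R, a ∉ P.asIdeal →
      red P (p + a • q) ≠ 0 := by
  induction n with
  | zero =>
    intro p x H
    refine ⟨0, Submodule.zero_mem _, fun P ha h0 => ?_⟩
    have h1 : 0 < rk P (insert p (Set.range x)) := by
      rcases H P ha with h | h
      · omega
      · have h2 : (0 : ℕ∞) < rk P (insert p (Set.range x)) := pos_of_gt h
        exact_mod_cast h2
    rw [smul_zero, add_zero] at h0
    have h3 : red P '' (insert p (Set.range x)) = {0} := by
      rw [Set.range_eq_empty, Set.image_insert_eq, h0]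
      simp
    unfold rk at h1
    rw [h3, Submodule.span_zero_singleton, finrank_bot] at h1
    exact lt_irrefl _ h1
  | succ n ih =>
    intro p x H
    obtain ⟨c, hc⟩ := step a (Fin.cons p (fun i => x i.succ) : Fin (n + 1) → κ → R) (x 0)
      (Fin.cons a (fun _ => 1) : Fin (n + 1) → R)
      (by
        intro P i ha
        refine Fin.cases ?_ (fun j => ?_) i
        · simpa using ha
        · simpa using (Ideal.ne_top_iff_one _).mp P.2.ne_top)
      (by
        have hx : insert (x 0) (Set.range
            (Fin.cons p (fun i => x i.succ) : Fin (n + 1) → κ → R))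
            = insert p (Set.range x) := by
          have : x = Fin.cons (x 0) (fun i => x i.succ) := (Fin.cons_self_tail x).symm
          conv_rhs => rw [this]
          rw [Fin.range_cons, Fin.range_cons, Set.insert_comm]
        rw [hx]
        simpa using H)
    have hr : (Set.range fun i => (Fin.cons p (fun i => x i.succ) : Fin (n + 1) → κ → R) i
          + ((Fin.cons a (fun _ => 1) : Fin (n + 1) → R) i * c i) • x 0)
        = insert (p + (a * c 0) • x 0) (Set.range fun i : Fin n => x i.succ + c i.succ • x 0) := by
      rw [← Fin.range_cons]
      congr 1
      funext i
      refine Fin.cases ?_ (fun j => ?_) i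
      · simp
      · simp
    rw [hr] at hc
    obtain ⟨q, hq, hq2⟩ := ih _ _ (by simpa using hc)
    have hmem : ∀ i, x i ∈ Submodule.span R (Set.range x) :=
      fun i => Submodule.subset_span ⟨i, rfl⟩
    refine ⟨c 0 • x 0 + q, Submodule.add_mem _ (Submodule.smul_mem _ _ (hmem 0)) ?_, ?_⟩
    · refine Submodule.span_le.mpr ?_ hq
      rintro _ ⟨i, rfl⟩
      exact Submodule.add_mem _ (hmem _) (Submodule.smul_mem _ _ (hmem 0))
    · intro P ha
      have := hq2 P ha
      rwa [add_assoc, mul_smul, ← smul_add] at this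

open TensorProduct in
lemma le_rk {R κ M : Type} [CommRing R] [Fintype κ] [AddCommGroup M] [Module R M]
    [Module.Finite R M] [Module.Projective R M]
    (i : M →ₗ[R] (κ → R)) (π : (κ → R) →ₗ[R] M) (h : π ∘ₗ i = LinearMap.id)
    (P : PrimeSpectrum R) (S : Set M) (hS : Submodule.span R S = ⊤) :
    Module.rankAtStalk (R := R) M P ≤ rk P (i '' S) := by
  classical
  rw [Module.rankAtStalk_eq]
  let K := P.asIdeal.ResidueField
  change Module.finrank K (K ⊗[R] M) ≤ _
  let ρ : (κ → K) →ₗ[K] K ⊗[R] M :=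
    Fintype.linearCombination K (fun j => (1 : K) ⊗ₜ[R] π (Pi.single j 1))
  have hρ : ∀ z : κ → R, ρ (red P z) = (1 : K) ⊗ₜ[R] π z := by
    intro z
    conv_rhs => rw [pi_eq_sum_univ' z]
    rw [map_sum, TensorProduct.tmul_sum]
    simp only [ρ, Fintype.linearCombination_apply]
    refine Finset.sum_congr rfl fun j _ => ?_
    rw [red_apply, map_smul, TensorProduct.tmul_smul, algebraMap_smul]
  let L := Submodule.span K (red P '' (i '' S))
  have htop : L.map ρ = ⊤ := by
    have h1 : ∀ m : M, (1 : K) ⊗ₜ[R] m ∈ L.map ρ := by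
      intro m
      have hm : m ∈ Submodule.span R S := hS ▸ Submodule.mem_top
      induction hm using Submodule.span_induction with
      | mem x hx =>
        refine ⟨red P (i x), Submodule.subset_span ⟨_, ⟨x, hx, rfl⟩, rfl⟩, ?_⟩
        rw [hρ]
        exact congrArg _ (LinearMap.congr_fun h x)
      | zero => rw [TensorProduct.tmul_zero]; exact Submodule.zero_mem _
      | add x y _ _ hx hy => rw [TensorProduct.tmul_add]; exact Submodule.add_mem _ hx hy
      | smul c x _ hx =>
        rw [TensorProduct.tmul_smul, ← algebraMap_smul K]
        exact Submodule.smul_mem _ _ hx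
    rw [eq_top_iff]
    intro t _
    induction t using TensorProduct.induction_on with
    | zero => exact Submodule.zero_mem _
    | add x y hx hy => exact Submodule.add_mem _ (hx trivial) (hy trivial)
    | tmul c m =>
      have : c ⊗ₜ[R] m = c • ((1 : K) ⊗ₜ[R] m) := by simp [TensorProduct.smul_tmul']
      rw [this]
      exact Submodule.smul_mem _ _ (h1 m)
  calc Module.finrank K (K ⊗[R] M) = Module.finrank K (L.map ρ) := by
        rw [htop, finrank_top]
    _ ≤ Module.finrank K L := Submodule.finrank_map_le _ _

/-- The key unimodularity statement. -/
lemma unimod {R M : Type} [CommRing R] [IsNoetherianRing R] [AddCommGroup M] [Module R M]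
    [Module.Finite R M] [Module.Projective R M] (d : ℕ)
    (hdim : ringKrullDim R ≤ (d : WithBot (WithTop ℕ)))
    (hr : ∀ P, d < Module.rankAtStalk (R := R) M P)
    (p : M) (a : R) (g : M →ₗ[R] R) (e : R) (hg : g p + e * a = 1) :
    ∃ (q : M) (f : M →ₗ[R] R), f (p + a • q) = 1 := by
  classical
  obtain ⟨k, π, i, -, -, hπ⟩ := Module.Finite.exists_comp_eq_id_of_projective R M
  obtain ⟨n, x, hx⟩ := Module.Finite.exists_fin (R := R) (M := M)
  have hπi : ∀ m, π (i m) = m := fun m => LinearMap.congr_fun hπ m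
  obtain ⟨q, hq, hq2⟩ := main_vec a n (i p) (fun j => i (x j)) (by
    intro P _
    right
    have h1 := le_rk i π hπ P (insert p (Set.range x))
      (eq_top_iff.mpr (hx ▸ Submodule.span_mono (Set.subset_insert _ _)))
    rw [Set.image_insert_eq, ← Set.range_comp] at h1
    have h2 : Order.coheight P ≤ (d : ℕ∞) := by
      have := (Order.coheight_le_krullDim P).trans hdim
      exact WithBot.coe_le_coe.mp this
    refine lt_of_le_of_lt h2 ?_
    exact_mod_cast lt_of_lt_of_le (hr P) h1)
  have hq' : q ∈ LinearMap.range i := by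
    refine Submodule.span_le.mpr ?_ hq
    rintro _ ⟨j, rfl⟩
    exact ⟨x j, rfl⟩
  obtain ⟨q, rfl⟩ := hq'
  have htop : Ideal.span (Set.range (i (p + a • q))) = ⊤ := by
    by_contra hne
    obtain ⟨m, hm, hle⟩ := Ideal.exists_le_maximal _ hne
    let P : PrimeSpectrum R := ⟨m, hm.isPrime⟩
    have hall : ∀ j, i (p + a • q) j ∈ m := fun j => hle (Ideal.subset_span ⟨j, rfl⟩)
    by_cases ha : a ∈ m
    · have h1 : g (p + a • q) ∈ m := by
        rw [← hπi (p + a • q), pi_eq_sum_univ' (i (p + a • q)), map_sum, map_sum]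
        refine Ideal.sum_mem _ fun j _ => ?_
        rw [map_smul, map_smul]
        exact Ideal.mul_mem_right _ _ (hall j)
      apply hm.ne_top
      rw [Ideal.eq_top_iff_one, ← hg]
      rw [map_add, map_smul, smul_eq_mul,
        Ideal.add_mem_iff_left _ (Ideal.mul_mem_right _ _ ha)] at h1
      exact Ideal.add_mem _ h1 (Ideal.mul_mem_left _ _ ha)
    · apply hq2 P ha
      rw [← map_smul, ← map_add, red_eq_zero]
      exact hall
  rw [Ideal.eq_top_iff_one, Ideal.mem_span_range_iff_exists_fun] at htop
  obtain ⟨c, hc⟩ := htop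
  refine ⟨q, (∑ j, c j • LinearMap.proj j) ∘ₗ i, ?_⟩
  rw [← hc]
  simp

/-- Cancellation of one free summand. -/
lemma cancel_one {R M N : Type} [CommRing R] [IsNoetherianRing R] [AddCommGroup M] [Module R M]
    [AddCommGroup N] [Module R N]
    [Module.Finite R M] [Module.Projective R M] (d : ℕ)
    (hdim : ringKrullDim R ≤ (d : WithBot (WithTop ℕ)))
    (hr : ∀ P, d < Module.rankAtStalk (R := R) M P)
    (φ : (N × R) ≃ₗ[R] (M × R)) : Nonempty (N ≃ₗ[R] M) := by
  obtain ⟨p, a, hpa⟩ : ∃ p a, φ (0, 1) = (p, a) := ⟨_, _, rfl⟩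
  let G : M × R →ₗ[R] R := LinearMap.snd R N R ∘ₗ φ.symm.toLinearMap
  have hG : G (p, a) = 1 := by simp [G, ← hpa]
  obtain ⟨q, f, hf⟩ := unimod d hdim hr p a (G ∘ₗ LinearMap.inl R M R) (G (0, 1)) (by
    refine Eq.trans ?_ hG
    rw [mul_comm, ← smul_eq_mul, ← map_smul, LinearMap.comp_apply, ← map_add]
    simp)
  -- the automorphism of `M × R` taking `(p, a)` to `(0, 1)`, then projected to `M`
  let u := p + a • q
  let h : M × R →ₗ[R] R := LinearMap.snd R M R + (1 - a) • f ∘ₗ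
    (LinearMap.fst R M R + (LinearMap.snd R M R).smulRight q)
  let T : M × R →ₗ[R] M :=
    LinearMap.fst R M R + (LinearMap.snd R M R).smulRight q - h.smulRight u
  have hh : ∀ x t, h (x, t) = t + (1 - a) * f (x + t • q) := fun x t => by simp [h]
  have hT : ∀ x t, T (x, t) = x + t • q - (t + (1 - a) * f (x + t • q)) • u := fun x t => by
    simp [T, h]
  have hTpa : T (p, a) = 0 := by
    rw [hT, hf]; simp [u]
  have hTker : ∀ x t, T (x, t) = 0 → ∃ s : R, (x, t) = s • (p, a) := by
    intro x t h0
    rw [hT, sub_eq_zero] at h0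
    set s := t + (1 - a) * f (x + t • q) with hs
    have h1 : f (x + t • q) = s := by rw [h0, map_smul, hf]; simp
    have h2 : t = s * a := by
      rw [h1] at hs
      linear_combination -hs
    refine ⟨s, ?_⟩
    rw [Prod.smul_mk, Prod.mk.injEq]
    refine ⟨?_, h2⟩
    have h3 : x = s • u - t • q := by rw [← h0]; abel
    rw [h3, h2]
    simp [u, smul_add, smul_smul]
  have hTsurj : ∀ m, ∃ x t, T (x, t) = m := by
    intro m
    -- solve with `t + (1 - a) * f (x + t • q) = 0`
    refine ⟨m - (-(1 - a) * f m) • q, -(1 - a) * f m, ?_⟩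
    rw [hT, sub_add_cancel]
    have : -(1 - a) * f m + (1 - a) * f m = 0 := by ring
    rw [this, zero_smul, sub_zero]
  let E : N →ₗ[R] M := T ∘ₗ φ.toLinearMap ∘ₗ LinearMap.inl R N R
  refine ⟨LinearEquiv.ofBijective E ⟨?_, ?_⟩⟩
  · rw [← LinearMap.ker_eq_bot, LinearMap.ker_eq_bot']
    intro y hy
    obtain ⟨s, hs⟩ := hTker (φ (y, 0)).1 (φ (y, 0)).2 hy
    have h1 : φ (y, 0) = φ (s • (0, 1)) := by rw [map_smul, hpa, ← hs]
    have h2 := φ.injective h1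
    simpa using congrArg Prod.fst h2
  · intro m
    obtain ⟨x, t, hxt⟩ := hTsurj m
    obtain ⟨⟨y, s⟩, hys⟩ := φ.surjective (x, t)
    refine ⟨y, ?_⟩
    have h1 : ((y, s) : N × R) = (y, 0) + s • (0, 1) := by simp
    rw [h1, map_add, map_smul, hpa] at hys
    rw [← hxt, ← hys, map_add, map_smul, hTpa]
    simp [E]

lemma cancel_many {R M N : Type} [CommRing R] [IsNoetherianRing R] [AddCommGroup M] [Module R M]
    [AddCommGroup N] [Module R N]
    [Module.Finite R M] [Module.Projective R M] (d : ℕ)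
    (hdim : ringKrullDim R ≤ (d : WithBot (WithTop ℕ)))
    (hr : ∀ P, d < Module.rankAtStalk (R := R) M P) (n : ℕ)
    (h : Nonempty ((N × (Fin n → R)) ≃ₗ[R] (M × (Fin n → R)))) : Nonempty (N ≃ₗ[R] M) := by
  induction n with
  | zero =>
    obtain ⟨φ⟩ := h
    exact ⟨(LinearEquiv.prodUnique (R := R) (M := N) (M₂ := Fin 0 → R)).symm ≪≫ₗ φ ≪≫ₗ
      LinearEquiv.prodUnique⟩
  | succ n ih =>
    obtain ⟨φ⟩ := h
    apply ih
    have e : ∀ (L : Type) [AddCommGroup L] [Module R L],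
        Nonempty (((L × (Fin n → R)) × R) ≃ₗ[R] (L × (Fin (n + 1) → R))) := fun L _ _ =>
      ⟨LinearEquiv.prodAssoc R L (Fin n → R) R ≪≫ₗ
        LinearEquiv.prodCongr (LinearEquiv.refl R L)
          (LinearEquiv.prodComm R (Fin n → R) R ≪≫ₗ Fin.consLinearEquiv R (fun _ => R))⟩
    obtain ⟨e1⟩ := e N
    obtain ⟨e2⟩ := e M
    refine cancel_one d hdim (fun P => ?_) (e1 ≪≫ₗ φ ≪≫ₗ e2.symm)
    rw [Module.rankAtStalk_prod]
    exact lt_of_lt_of_le (hr P) (Nat.le_add_right _ _)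

end BassCancel

/-- Bass's cancellation theorem: over a Noetherian commutative ring of Krull
dimension `d`, two stably isomorphic finitely generated projective modules of
constant rank `r > d` are isomorphic. -/
theorem stmt1 {R : Type} [CommRing R] [IsNoetherianRing R]
    (d : ℕ) (hdim : ringKrullDim R ≤ (d : WithBot (WithTop ℕ)))
    (M N : Type) [AddCommGroup M] [Module R M] [AddCommGroup N] [Module R N]
    [Module.Finite R M] [Module.Projective R M]
    [Module.Finite R N] [Module.Projective R N]
    (r : ℕ) (hr : d < r)
    (hM : HasConstantRank R M r) (hN : HasConstantRank R N r)
    (n m : ℕ) (hstab : Nonempty ((M × (Fin n → R)) ≃ₗ[R] (N × (Fin m → R)))) :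
    Nonempty (M ≃ₗ[R] N) := by
  rcases subsingleton_or_nontrivial R with hR | hR
  · have := Module.subsingleton R M
    have := Module.subsingleton R N
    exact ⟨0⟩
  · have hM' : ∀ P, Module.rankAtStalk (R := R) M P = r := fun P => (hM P).2
    have hN' : ∀ P, Module.rankAtStalk (R := R) N P = r := fun P => (hN P).2
    have hnm : n = m := by
      obtain ⟨φ⟩ := hstab
      obtain ⟨P⟩ := (inferInstance : Nonempty (PrimeSpectrum R))
      have h := congrFun (Module.rankAtStalk_eq_of_equiv φ) P
      rw [Module.rankAtStalk_prod, Module.rankAtStalk_prod] at h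
      simp only [Pi.add_apply, hM', hN', Module.rankAtStalk_eq_finrank_of_free] at h
      simpa using h
    subst hnm
    exact BassCancel.cancel_many d hdim (fun P => by rw [hN']; exact hr) n hstab
end

section
/- Let R be a Noetherian commutative ring of Krull dimension d and P a finitely generated projective R-module of constant rank n with n > d. Then P ≅ P₀ ⊕ R^{n−d} for some projective R-module P₀. -/
section
open Module

theorem half_minor {K : Type*} [Field K] {a b : ℕ} (A : Matrix (Fin a) (Fin b) K) (s : ℕ)
    (h : s ≤ A.rank) : ∃ e : Fin s → Fin a, LinearIndependent K (A.submatrix e id).row := by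
  rw [A.rank_eq_finrank_span_row] at h
  obtain ⟨f, hf, -, hli⟩ := Submodule.exists_fun_fin_finrank_span_eq K (Set.range A.row)
  choose e he using hf
  refine ⟨fun i => e (Fin.castLE h i), ?_⟩
  have := hli.comp (Fin.castLE h) (Fin.castLE_injective h)
  have h2 : (A.submatrix (fun i => e (Fin.castLE h i)) id).row = f ∘ Fin.castLE h := by
    funext i
    exact he _
  rw [h2]
  exact this

theorem exists_minor {K : Type*} [Field K] {a b : ℕ} (A : Matrix (Fin a) (Fin b) K) (s : ℕ)
    (h : s ≤ A.rank) : ∃ (e : Fin s → Fin a) (f : Fin s → Fin b), (A.submatrix e f).det ≠ 0 := by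
  obtain ⟨e, he⟩ := half_minor A s h
  have h1 := he.rank_matrix
  rw [← Matrix.rank_transpose, Fintype.card_fin] at h1
  obtain ⟨f, hf⟩ := half_minor _ s h1.ge
  refine ⟨e, f, ?_⟩
  have := Matrix.linearIndependent_rows_iff_isUnit.mp hf
  rw [Matrix.isUnit_iff_isUnit_det, isUnit_iff_ne_zero] at this
  rw [← Matrix.det_transpose]
  exact this

theorem minor_rank {K : Type*} [Field K] {a b : ℕ} (A : Matrix (Fin a) (Fin b) K) (s : ℕ)
    (e : Fin s → Fin a) (f : Fin s → Fin b) (h : (A.submatrix e f).det ≠ 0) : s ≤ A.rank := by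
  have h1 : (A.submatrix e f).rank = s := by
    rw [Matrix.rank_of_isUnit _ ((Matrix.isUnit_iff_isUnit_det _).2 (isUnit_iff_ne_zero.2 h))]
    simp
  rw [← h1]
  exact Matrix.rank_submatrix_le A e f

/-- new vectors `v i + a i * v last` -/
def shiftFam {K : Type*} [CommRing K] {u b : ℕ} (v : Matrix (Fin (u+1)) (Fin b) K) (a : Fin u → K) :
    Matrix (Fin u) (Fin b) K := fun i => v i.castSucc + a i • v (Fin.last u)

theorem rank_le_shift {K : Type*} [Field K] {u b : ℕ} (v : Matrix (Fin (u+1)) (Fin b) K)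
    (a : Fin u → K) : v.rank ≤ (shiftFam v a).rank + 1 := by
  rw [Matrix.rank_eq_finrank_span_row, Matrix.rank_eq_finrank_span_row]
  have : Submodule.span K (Set.range v.row) ≤
      Submodule.span K (Set.range (shiftFam v a).row) ⊔ Submodule.span K {v (Fin.last u)} := by
    rw [Submodule.span_le]
    rintro _ ⟨i, rfl⟩
    induction i using Fin.lastCases with
    | last => exact Submodule.mem_sup_right (Submodule.mem_span_singleton_self _)
    | cast i =>
      have : v.row i.castSucc = (shiftFam v a).row i - a i • v (Fin.last u) := by
        ext j; simp [shiftFam, Matrix.row]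
      rw [this]
      exact Submodule.sub_mem _ (Submodule.mem_sup_left (Submodule.subset_span ⟨i, rfl⟩))
        (Submodule.mem_sup_right (Submodule.smul_mem _ _ (Submodule.mem_span_singleton_self _)))
  refine (Submodule.finrank_mono this).trans ((Submodule.finrank_add_le_finrank_add_finrank _ _).trans ?_)
  gcongr
  refine (finrank_span_le_card (R := K) _).trans ?_
  simp

theorem shift_field {K : Type*} [Field K] {u b : ℕ} (v : Matrix (Fin (u+1)) (Fin b) K)
    (hv : v.rank < u + 1) :
    v.rank ≤ (shiftFam v 0).rank ∨
    ∃ j : Fin u, ∀ c : K, c ≠ 0 → v.rank ≤ (shiftFam v (Pi.single j c)).rank := by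
  by_cases hli : LinearIndependent K (shiftFam v 0).row
  · left
    rw [hli.rank_matrix, Fintype.card_fin]; omega
  · right
    rw [linearIndependent_iff_notMem_span] at hli
    push Not at hli
    obtain ⟨j, hj⟩ := hli
    refine ⟨j, fun c hc => ?_⟩
    rw [Matrix.rank_eq_finrank_span_row, Matrix.rank_eq_finrank_span_row]
    apply Submodule.finrank_mono
    set S := Submodule.span K (Set.range (shiftFam v (Pi.single j c)).row)
    have h1 : ∀ i, i ≠ j → v i.castSucc ∈ S := by
      intro i hi
      apply Submodule.subset_span
      refine ⟨i, ?_⟩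
      ext k; simp [shiftFam, Matrix.row, hi]
    have h2 : v j.castSucc ∈ S := by
      have h3 : (shiftFam v 0).row j = v j.castSucc := by ext k; simp [shiftFam, Matrix.row]
      rw [← h3]
      refine Submodule.span_le.2 ?_ hj
      rintro _ ⟨i, hi, rfl⟩
      have h3 : (shiftFam v 0).row i = v i.castSucc := by ext k; simp [shiftFam, Matrix.row]
      rw [h3]
      exact h1 i (by simpa using hi)
    have h4 : v (Fin.last u) ∈ S := by
      have : (shiftFam v (Pi.single j c)).row j ∈ S := Submodule.subset_span ⟨j, rfl⟩
      have h5 : v (Fin.last u) = c⁻¹ • ((shiftFam v (Pi.single j c)).row j - v j.castSucc) := by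
        ext k; simp [shiftFam, Matrix.row, hc]
      rw [h5]
      exact S.smul_mem _ (S.sub_mem this h2)
    rw [Submodule.span_le]
    rintro _ ⟨i, rfl⟩
    induction i using Fin.lastCases with
    | last => exact h4
    | cast i =>
      by_cases hi : i = j
      · subst hi; exact h2
      · exact h1 i hi

/-- rank at a prime -/
noncomputable def rkAt {R : Type*} [CommRing R] {u b : ℕ} (p : PrimeSpectrum R)
    (m : Matrix (Fin u) (Fin b) R) : ℕ :=
  (m.map (algebraMap R p.asIdeal.ResidueField)).rank

theorem map_shiftFam {R K : Type*} [CommRing R] [CommRing K] (f : R →+* K) {u b : ℕ}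
    (m : Matrix (Fin (u+1)) (Fin b) R) (a : Fin u → R) :
    (shiftFam m a).map f = shiftFam (m.map f) (fun i => f (a i)) := by
  ext i j; simp [shiftFam]

/-- all the shifted vectors, together with the old last one -/
def snocFam {K : Type*} [CommRing K] {u b : ℕ} (v : Matrix (Fin (u+1)) (Fin b) K) (a : Fin u → K) :
    Matrix (Fin (u+1)) (Fin b) K := fun i =>
  Fin.lastCases (motive := fun _ => Fin b → K) (v (Fin.last u))
    (fun i => v i.castSucc + a i • v (Fin.last u)) i

theorem snocFam_last {K : Type*} [CommRing K] {u b : ℕ} (v : Matrix (Fin (u+1)) (Fin b) K)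
    (a : Fin u → K) : snocFam v a (Fin.last u) = v (Fin.last u) := by
  simp [snocFam]

theorem snocFam_castSucc {K : Type*} [CommRing K] {u b : ℕ} (v : Matrix (Fin (u+1)) (Fin b) K)
    (a : Fin u → K) (i : Fin u) :
    snocFam v a i.castSucc = v i.castSucc + a i • v (Fin.last u) := by
  simp [snocFam]

theorem shiftFam_add {R : Type*} [CommRing R] {u b : ℕ}
    (m : Matrix (Fin (u+1)) (Fin b) R) (a c : Fin u → R) :
    shiftFam m (a + c) =
      shiftFam (snocFam m a) c := by
  ext i j; simp [shiftFam, snocFam_last, snocFam_castSucc]; ring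

theorem rank_snoc_shift {K : Type*} [Field K] {u b : ℕ} (v : Matrix (Fin (u+1)) (Fin b) K)
    (a : Fin u → K) :
    v.rank = (snocFam v a).rank := by
  rw [Matrix.rank_eq_finrank_span_row, Matrix.rank_eq_finrank_span_row]
  suffices H : Submodule.span K (Set.range v.row) =
      Submodule.span K (Set.range (snocFam v a).row) by rw [H]
  apply le_antisymm
  · rw [Submodule.span_le]
    set w := snocFam v a with hwdef
    have hw : ∀ i, w i ∈ Submodule.span K (Set.range w.row) :=
      fun i => Submodule.subset_span ⟨i, rfl⟩
    rintro _ ⟨i, rfl⟩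
    induction i using Fin.lastCases with
    | last => simpa [w, snocFam_last, Matrix.row] using hw (Fin.last u)
    | cast i =>
      have : v.row i.castSucc = w i.castSucc - a i • w (Fin.last u) := by
        ext j; simp [Matrix.row, w, snocFam_last, snocFam_castSucc]
      rw [this]
      exact Submodule.sub_mem _ (hw _) (Submodule.smul_mem _ _ (hw _))
  · rw [Submodule.span_le]
    have hw : ∀ i, v i ∈ Submodule.span K (Set.range v.row) :=
      fun i => Submodule.subset_span ⟨i, rfl⟩
    rintro _ ⟨i, rfl⟩
    induction i using Fin.lastCases with
    | last => simpa [Matrix.row, snocFam_last] using hw (Fin.last u)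
    | cast i =>
      simpa [Matrix.row, snocFam_castSucc] using
        Submodule.add_mem _ (hw i.castSucc) (Submodule.smul_mem _ (a i) (hw (Fin.last u)))

theorem patch {R : Type*} [CommRing R] {u b : ℕ} (m : Matrix (Fin (u+1)) (Fin b) R)
    (L : Finset (PrimeSpectrum R)) : (∀ p ∈ L, rkAt p m < u + 1) →
    ∃ a : Fin u → R, ∀ p ∈ L, rkAt p m ≤ rkAt p (shiftFam m a) := by
  classical
  induction L using Finset.strongInduction with
  | H L ih =>
  intro hL
  rcases L.eq_empty_or_nonempty with rfl | hne
  · exact ⟨0, by simp⟩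
  obtain ⟨p, hp, hmin⟩ := L.exists_minimal hne
  obtain ⟨a, ha⟩ := ih (L.erase p) (Finset.erase_ssubset hp)
    (fun q hq => hL q (Finset.mem_of_mem_erase hq))
  have hb : ∃ c : R, (∀ q ∈ L.erase p, c ∈ q.asIdeal) ∧ c ∉ p.asIdeal := by
    by_contra hcon
    push Not at hcon
    have h1 : (L.erase p).inf PrimeSpectrum.asIdeal ≤ p.asIdeal := by
      intro c hc
      exact hcon c (fun q hq => (Finset.inf_le (f := PrimeSpectrum.asIdeal) hq) hc)
    obtain ⟨q, hq, hqp⟩ := (Ideal.IsPrime.inf_le' p.2).1 h1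
    have h2 : p ≤ q := hmin (Finset.mem_of_mem_erase hq) hqp
    exact (Finset.ne_of_mem_erase hq) (le_antisymm hqp h2)
  obtain ⟨c, hc, hcp⟩ := hb
  set K := p.asIdeal.ResidueField
  set φ := algebraMap R K
  have hr := rank_snoc_shift (m.map φ) (fun i => φ (a i))
  have hcK : φ c ≠ 0 := by rwa [Ne, Ideal.algebraMap_residueField_eq_zero]
  have key : ∃ a' : Fin u → R, (∀ i, a' i = 0 ∨ a' i = c) ∧
      rkAt p m ≤ rkAt p (shiftFam m (a + a')) := by
    have hm := hL p hp
    unfold rkAt at hm ⊢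
    change (m.map φ).rank < _ at hm
    rw [hr] at hm
    change ∃ a' : Fin u → R, (∀ i, a' i = 0 ∨ a' i = c) ∧
      (m.map φ).rank ≤ ((shiftFam m (a + a')).map φ).rank
    rw [hr]
    rcases shift_field _ hm with h | ⟨j, h⟩
    · refine ⟨0, fun i => Or.inl rfl, ?_⟩
      rw [map_shiftFam]
      have : (fun i => φ ((a + 0) i)) = (fun i => φ (a i)) + 0 := by ext; simp
      rwa [this, shiftFam_add]
    · refine ⟨Pi.single j c, fun i => ?_, ?_⟩
      · by_cases hi : i = j
        · subst hi; simp
        · simp [hi]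
      · rw [map_shiftFam]
        have : (fun i => φ ((a + Pi.single j c : Fin u → R) i)) = (fun i => φ (a i)) + Pi.single j (φ c) := by
          ext i
          by_cases hi : i = j
          · subst hi; simp
          · simp [hi]
        rw [this, shiftFam_add]
        exact h _ hcK
  obtain ⟨a', ha', hk⟩ := key
  refine ⟨a + a', fun q hq => ?_⟩
  by_cases hqp : q = p
  · subst hqp; exact hk
  have hq' := Finset.mem_erase.2 ⟨hqp, hq⟩
  refine (ha q hq').trans (le_of_eq ?_)
  unfold rkAt
  rw [map_shiftFam, map_shiftFam]
  congr 2
  ext i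
  have : algebraMap R q.asIdeal.ResidueField (a' i) = 0 := by
    rw [Ideal.algebraMap_residueField_eq_zero]
    rcases ha' i with h | h <;> rw [h]
    · exact zero_mem _
    · exact hc q hq'
  simp [this]

/-- the generic position condition -/
def GoodFam {R : Type*} [CommRing R] (d : ℕ) {u b : ℕ} (m : Matrix (Fin u) (Fin b) R) : Prop :=
  ∀ p : PrimeSpectrum R, u ≤ rkAt p m ∨ ((d + 1 : ℕ) : ℕ∞) ≤ (rkAt p m : ℕ∞) + p.asIdeal.height

theorem det_map_sub {R : Type*} [CommRing R] {u b s : ℕ} (p : PrimeSpectrum R)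
    (m : Matrix (Fin u) (Fin b) R) (e : Fin s → Fin u) (f : Fin s → Fin b) :
    ((m.map (algebraMap R p.asIdeal.ResidueField)).submatrix e f).det ≠ 0 ↔
      (m.submatrix e f).det ∉ p.asIdeal := by
  rw [← Ideal.algebraMap_residueField_eq_zero, RingHom.map_det, RingHom.mapMatrix_apply,
    Matrix.submatrix_map]

theorem minors_iff {R : Type*} [CommRing R] {u b : ℕ} (m : Matrix (Fin u) (Fin b) R) (t : ℕ) :
    ∃ J : Ideal R, ∀ p : PrimeSpectrum R, J ≤ p.asIdeal ↔ rkAt p m ≤ t := by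
  refine ⟨Ideal.span {x | ∃ (e : Fin (t+1) → Fin u) (f : Fin (t+1) → Fin b),
    x = (m.submatrix e f).det}, fun p => ?_⟩
  rw [Ideal.span_le]
  constructor
  · intro h
    by_contra! hlt
    obtain ⟨e, f, hef⟩ := exists_minor _ (t+1) hlt
    rw [det_map_sub] at hef
    exact hef (h ⟨e, f, rfl⟩)
  · rintro h _ ⟨e, f, rfl⟩
    by_contra hef
    have h2 := minor_rank _ _ _ _ ((det_map_sub p m e f).2 hef)
    unfold rkAt at h
    omega

theorem step {R : Type*} [CommRing R] [IsNoetherianRing R] (d : ℕ) {u b : ℕ}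
    (hdim : ∀ p : PrimeSpectrum R, p.asIdeal.height ≤ d)
    (m : Matrix (Fin (u+1)) (Fin b) R) (hm : GoodFam d m) :
    ∃ a : Fin u → R, GoodFam d (shiftFam m a) := by
  have hnat : ∀ p : PrimeSpectrum R, ∃ h : ℕ, p.asIdeal.height = h := fun p =>
    ⟨_, (ENat.natCast_toNat (ne_top_of_le_ne_top (ENat.natCast_ne_top d) (hdim p))).symm⟩
  choose ht hht using hnat
  have hm' : ∀ p, u + 1 ≤ rkAt p m ∨ d + 1 ≤ rkAt p m + ht p := by
    intro p
    have := hm p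
    rw [hht] at this
    exact_mod_cast this
  have hfin : ∀ t < u + 1, {p : PrimeSpectrum R | rkAt p m = t ∧ t + ht p = d + 1}.Finite := by
    intro t htu
    obtain ⟨J, hJ⟩ := minors_iff m t
    have h1 := J.finite_minimalPrimes_of_isNoetherianRing R
    refine Set.Finite.of_finite_image (f := PrimeSpectrum.asIdeal) (h1.subset ?_)
      (fun x _ y _ h => PrimeSpectrum.ext h)
    rintro _ ⟨p, ⟨hp1, hp2⟩, rfl⟩
    refine ⟨⟨p.2, (hJ p).2 hp1.le⟩, ?_⟩
    rintro q ⟨hq, hJq⟩ hqp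
    have h2 := (hJ ⟨q, hq⟩).1 hJq
    have h3 := hm' ⟨q, hq⟩
    have h4 : ht p ≤ ht ⟨q, hq⟩ := by omega
    have h5 : p.asIdeal.height ≤ q.height := by
      rw [hht p, show q.height = _ from hht ⟨q, hq⟩]; exact_mod_cast h4
    exact (Ideal.eq_of_le_of_height_le q hqp h5).ge
  have hfin2 : {p : PrimeSpectrum R | rkAt p m < u + 1 ∧ rkAt p m + ht p = d + 1}.Finite := by
    refine ((Set.finite_lt_nat (u+1)).biUnion hfin).subset ?_
    rintro p ⟨h1, h2⟩
    simp only [Set.mem_iUnion]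
    exact ⟨_, h1, rfl, h2⟩
  obtain ⟨a, ha⟩ := patch m hfin2.toFinset (fun p hp => (hfin2.mem_toFinset.1 hp).1)
  refine ⟨a, fun p => ?_⟩
  rw [hht]
  norm_cast
  have h1 : rkAt p m ≤ rkAt p (shiftFam m a) + 1 := by
    unfold rkAt
    rw [map_shiftFam]
    exact rank_le_shift _ _
  have h2 := hm' p
  by_cases hp : rkAt p m < u + 1 ∧ rkAt p m + ht p = d + 1
  · have := ha p (hfin2.mem_toFinset.2 hp)
    omega
  · omega

theorem descend {R : Type*} [CommRing R] [IsNoetherianRing R] (d : ℕ) {b : ℕ}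
    (hdim : ∀ p : PrimeSpectrum R, p.asIdeal.height ≤ d) (Q : Submodule R (Fin b → R)) (u : ℕ) :
    ∀ (m : Matrix (Fin (u+1)) (Fin b) R), (∀ i, m i ∈ Q) → GoodFam d m →
    ∃ x ∈ Q, ∀ p : PrimeSpectrum R, ∃ j, x j ∉ p.asIdeal := by
  induction u with
  | zero =>
    intro m hQ hm
    refine ⟨m 0, hQ 0, fun p => ?_⟩
    by_contra! hcon
    have h0 : rkAt p m = 0 := by
      unfold rkAt
      have : m.map (algebraMap R p.asIdeal.ResidueField) = 0 := by
        ext i j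
        have := hcon j
        rw [← Ideal.algebraMap_residueField_eq_zero] at this
        obtain rfl : i = 0 := Fin.ext (by omega)
        simpa using this
      rw [this, Matrix.rank_zero]
    rcases hm p with h | h
    · omega
    · rw [h0] at h
      have := h.trans (add_le_add_right (hdim p) _)
      norm_cast at this
      omega
  | succ u ih =>
    intro m hQ hm
    obtain ⟨a, ha⟩ := step d hdim m hm
    exact ih _ (fun i => Q.add_mem (hQ _) (Q.smul_mem _ (hQ _))) ha

open TensorProduct in
theorem fiber_le {R P : Type*} [CommRing R] [AddCommGroup P] [Module R P] {N : ℕ}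
    (f : (Fin N → R) →ₗ[R] P) (g : P →ₗ[R] (Fin N → R)) (hfg : f ∘ₗ g = LinearMap.id)
    {u : ℕ} (m : Matrix (Fin u) (Fin N) R) (hm : ∀ i, ∃ k, m k = g (f (Pi.single i 1)))
    (K : Type*) [Field K] [Algebra R K] :
    finrank K (K ⊗[R] P) ≤ (m.map (algebraMap R K)).rank := by
  let G : K ⊗[R] P →ₗ[K] (Fin N → K) :=
    (TensorProduct.piScalarRight R K K (Fin N)).toLinearMap ∘ₗ g.baseChange K
  have hG : Function.Injective G := by
    apply (TensorProduct.piScalarRight R K K (Fin N)).injective.comp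
    apply Function.LeftInverse.injective (g := f.baseChange K)
    intro x
    rw [← LinearMap.comp_apply, ← LinearMap.baseChange_comp, hfg]
    simp
  rw [← LinearMap.finrank_range_of_inj hG, Matrix.rank_eq_finrank_span_row]
  apply Submodule.finrank_mono
  rintro _ ⟨y, rfl⟩
  induction y with
  | zero => simp
  | add x y hx hy => rw [map_add]; exact Submodule.add_mem _ hx hy
  | tmul k x =>
    have hGk : ∀ z : P, G (k ⊗ₜ z) = k • fun j => algebraMap R K (g z j) := by
      intro z
      ext j
      simp [G, Algebra.smul_def, mul_comm]
    have hx : x = f (g x) := by rw [← LinearMap.comp_apply, hfg]; rfl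
    rw [hGk]
    apply Submodule.smul_mem
    rw [hx]
    generalize g x = c
    have hc : (fun j => algebraMap R K (g (f c) j)) =
        ∑ i, algebraMap R K (c i) • fun j => algebraMap R K (g (f (Pi.single i 1)) j) := by
      have h1 : c = ∑ i, c i • (Pi.single i 1 : Fin N → R) := pi_eq_sum_univ' c
      ext j
      conv_lhs => rw [h1]
      simp only [map_sum, map_smul, Finset.sum_apply, Pi.smul_apply, smul_eq_mul, map_mul]
    rw [hc]
    refine Submodule.sum_mem _ fun i _ => Submodule.smul_mem _ _ (Submodule.subset_span ?_)
    obtain ⟨k, hk⟩ := hm i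
    exact ⟨k, by ext j; simp [Matrix.row, ← hk]⟩

theorem exists_unimodular {R P : Type*} [CommRing R] [IsNoetherianRing R] (d : ℕ)
    (hdim : ∀ p : PrimeSpectrum R, p.asIdeal.height ≤ d)
    [AddCommGroup P] [Module R P] [Module.Finite R P] [Module.Projective R P]
    (hr : ∀ p : PrimeSpectrum R, d + 1 ≤ Module.rankAtStalk P p) :
    ∃ (x : P) (φ : P →ₗ[R] R), φ x = 1 := by
  obtain ⟨N, f, g, -, -, hfg⟩ := Module.Finite.exists_comp_eq_id_of_projective R P
  let m : Matrix (Fin (N+1)) (Fin N) R :=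
    Fin.cons (α := fun _ => Fin N → R) 0 (fun i => g (f (Pi.single i 1)))
  have hgood : GoodFam d m := by
    intro p
    right
    have h1 := fiber_le f g hfg m (fun i => ⟨i.succ, rfl⟩) p.asIdeal.ResidueField
    have h2 := hr p
    rw [Module.rankAtStalk_eq] at h2
    have h3 : d + 1 ≤ rkAt p m := h2.trans h1
    exact le_add_right (by exact_mod_cast h3)
  obtain ⟨_, ⟨x, rfl⟩, hx⟩ := descend d hdim (LinearMap.range g) N m (by
    intro i
    induction i using Fin.cases with
    | zero => exact zero_mem _
    | succ i => exact ⟨_, rfl⟩) hgood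
  have htop : Ideal.span (Set.range (g x)) = ⊤ := by
    by_contra hne
    obtain ⟨M, hM, hle⟩ := Ideal.exists_le_maximal _ hne
    obtain ⟨j, hj⟩ := hx ⟨M, hM.isPrime⟩
    exact hj (hle (Ideal.subset_span ⟨j, rfl⟩))
  obtain ⟨c, hc⟩ := (Submodule.mem_span_range_iff_exists_fun R).1
    ((Ideal.eq_top_iff_one _).1 htop)
  refine ⟨x, (∑ j, c j • LinearMap.proj j) ∘ₗ g, ?_⟩
  simpa using hc

theorem split_one {R P : Type*} [CommRing R] [AddCommGroup P] [Module R P]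
    (x : P) (φ : P →ₗ[R] R) (h : φ x = 1) : Nonempty (P ≃ₗ[R] (LinearMap.ker φ × R)) := by
  refine ⟨LinearEquiv.ofLinearMap
    (LinearMap.prod ((LinearMap.id - φ.smulRight x).codRestrict (LinearMap.ker φ)
      (fun y => by simp [h])) φ)
    (LinearMap.coprod (LinearMap.ker φ).subtype (LinearMap.toSpanSingleton R P x)) ?_ ?_⟩
  · ext y
    · change (y : P) + (0 : R) • x - φ ((y : P) + (0 : R) • x) • x = y
      simp
    · simp
    · change (0 : P) + (1 : R) • x - φ ((0 : P) + (1 : R) • x) • x = 0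
      simp [h]
    · simp [h]
  · ext y
    change y - φ y • x + φ y • x = y
    simp

theorem split_many {R : Type*} [CommRing R] [IsNoetherianRing R] (d : ℕ)
    (hdim : ∀ p : PrimeSpectrum R, p.asIdeal.height ≤ d) (k : ℕ) :
    ∀ (P : Type*) [AddCommGroup P] [Module R P] [Module.Finite R P] [Module.Projective R P],
    (∀ p : PrimeSpectrum R, d + k ≤ Module.rankAtStalk P p) →
    ∃ P₀ : Submodule R P, Module.Projective R P₀ ∧ Nonempty (P ≃ₗ[R] (P₀ × (Fin k → R))) := by
  induction k with
  | zero =>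
    intro P _ _ _ _ _
    refine ⟨⊤, Module.Projective.of_equiv Submodule.topEquiv.symm, ⟨?_⟩⟩
    exact Submodule.topEquiv.symm ≪≫ₗ LinearEquiv.prodUnique.symm
  | succ k ih =>
    intro P _ _ _ _ hr
    obtain ⟨x, φ, h⟩ := exists_unimodular d hdim (fun p => le_trans (by omega) (hr p))
    obtain ⟨e⟩ := split_one x φ h
    have hproj : Module.Projective R (LinearMap.ker φ) := by
      apply Module.Projective.of_split (e.symm.toLinearMap ∘ₗ LinearMap.inl R _ R)
        (LinearMap.fst R _ R ∘ₗ e.toLinearMap)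
      ext y; simp
    obtain ⟨Q, hQ, ⟨e'⟩⟩ := ih (LinearMap.ker φ) (by
      intro p
      have h1 := hr p
      have : Nontrivial R := p.nontrivial
      rw [Module.rankAtStalk_eq_of_equiv e, Module.rankAtStalk_prod] at h1
      simp at h1
      omega)
    let eQ := Submodule.equivMapOfInjective (LinearMap.ker φ).subtype
      (Submodule.subtype_injective _) Q
    refine ⟨Q.map (LinearMap.ker φ).subtype, Module.Projective.of_equiv eQ, ⟨?_⟩⟩
    refine e ≪≫ₗ (LinearEquiv.prodCongr e' (LinearEquiv.refl R R)) ≪≫ₗ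
      LinearEquiv.prodAssoc R _ _ _ ≪≫ₗ LinearEquiv.prodCongr eQ ?_
    exact LinearEquiv.prodComm R _ _ ≪≫ₗ Fin.consLinearEquiv R (fun _ : Fin (k+1) => R)

end

/-- Serre's splitting theorem: a finitely generated projective module of constant
rank `n > d` over a Noetherian commutative ring of Krull dimension `d` splits off
a free summand of rank `n - d`. -/
theorem stmt2 {R : Type} [CommRing R] [IsNoetherianRing R]
    (d : ℕ) (hdim : ringKrullDim R ≤ (d : WithBot (WithTop ℕ)))
    (P : Type) [AddCommGroup P] [Module R P]
    [Module.Finite R P] [Module.Projective R P]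
    (n : ℕ) (hrank : HasConstantRank R P n) (hn : d < n) :
    ∃ P₀ : Submodule R P, Module.Projective R P₀ ∧
      Nonempty (P ≃ₗ[R] (P₀ × (Fin (n - d) → R))) := by
  refine split_many d (fun p => ?_) (n - d) P (fun p => ?_)
  · have h := (Ideal.height_le_ringKrullDim_of_isPrime (I := p.asIdeal)).trans hdim
    exact WithBot.coe_le_coe.1 h
  · have h := (hrank p).2
    have h2 : Module.rankAtStalk P p = n := h
    omega
end

section
/- Let f : X → Y be a finite surjective morphism of schemes with Y affine... Conversely (Chevalley's theorem): let f : X → Y be a finite surjective morphism of Noetherian schemes. If X is affine, then Y is affine. -/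
namespace Chev

open AlgebraicGeometry CategoryTheory TopologicalSpace

universe u



/-- restriction of sections -/
noncomputable def res {Y : Scheme.{u}} {U V : Y.Opens} (h : V ≤ U) : Γ(Y, U) →+* Γ(Y, V) :=
  (Y.presheaf.map (homOfLE h).op).hom

/-- pull back of sections -/
noncomputable def pb {Z Y : Scheme.{u}} (i : Z ⟶ Y) (U : Y.Opens) :
    Γ(Y, U) →+* Γ(Z, i ⁻¹ᵁ U) := (i.app U).hom

lemma res_res {Y : Scheme.{u}} {U V W : Y.Opens} (h : V ≤ U) (h' : W ≤ V) (a : Γ(Y, U)) :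
    res h' (res h a) = res (h'.trans h) a := by
  unfold res
  rw [← RingHom.comp_apply, ← CommRingCat.hom_comp, ← Functor.map_comp]
  rfl

lemma res_self {Y : Scheme.{u}} {U : Y.Opens} (h : U ≤ U) (a : Γ(Y, U)) :
    res h a = a := by
  unfold res
  rw [show (homOfLE h).op = 𝟙 _ from rfl, Y.presheaf.map_id]
  rfl

lemma pre_le {Z Y : Scheme.{u}} (i : Z ⟶ Y) {U V : Y.Opens} (h : V ≤ U) :
    i ⁻¹ᵁ V ≤ i ⁻¹ᵁ U := fun _ hx => h hx

lemma pb_res {Z Y : Scheme.{u}} (i : Z ⟶ Y) {U V : Y.Opens} (h : V ≤ U) (a : Γ(Y, U)) :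
    pb i V (res h a) = res (pre_le i h) (pb i U a) := by
  unfold res pb
  rw [← RingHom.comp_apply, ← CommRingCat.hom_comp, ← RingHom.comp_apply, ← CommRingCat.hom_comp,
    i.naturality]
  rfl

lemma glue {Y : Scheme.{u}} {ι : Type*} (U : ι → Y.Opens) (hU : iSup U = ⊤)
    (s : ∀ i, Γ(Y, U i))
    (hs : ∀ i j, res (inf_le_left : U i ⊓ U j ≤ U i) (s i) = res inf_le_right (s j)) :
    ∃ a : Γ(Y, ⊤), ∀ i, res le_top a = s i := by
  obtain ⟨a, ha, -⟩ := TopCat.Sheaf.existsUnique_gluing' Y.sheaf U ⊤ (fun i => homOfLE le_top)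
    hU.ge s (fun i j => hs i j)
  exact ⟨a, ha⟩

lemma sep {Y : Scheme.{u}} {ι : Type*} {V : Y.Opens} (U : ι → Y.Opens) (hUV : ∀ i, U i ≤ V)
    (hU : V ≤ iSup U)
    (a b : Γ(Y, V)) (h : ∀ i, res (hUV i) a = res (hUV i) b) : a = b :=
  TopCat.Sheaf.eq_of_locally_eq' Y.sheaf U V (fun i => homOfLE (hUV i)) hU a b h

lemma ext_basic {Y : Scheme.{u}} {W W' : Y.Opens} (hW : IsAffineOpen W) (G : Γ(Y, W))
    (h : W' = Y.basicOpen G) (hle : W' ≤ W) (e : Γ(Y, W')) :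
    ∃ (n : ℕ) (y : Γ(Y, W)), res hle y = res hle G ^ n * e := by
  subst h
  exact exists_eq_pow_mul_of_isAffineOpen Y W hW G e

lemma zero_basic {Y : Scheme.{u}} {W W' : Y.Opens} (hW : IsAffineOpen W) (G : Γ(Y, W))
    (h : W' = Y.basicOpen G) (hle : W' ≤ W) (a : Γ(Y, W)) (ha : res hle a = 0) :
    ∃ (n : ℕ), G ^ n * a = 0 := by
  subst h
  exact exists_pow_mul_eq_zero_of_res_basicOpen_eq_zero_of_isAffineOpen Y hW a G ha

lemma pb_surj {Z Y : Scheme.{u}} (i : Z ⟶ Y) [IsClosedImmersion i] {W : Y.Opens}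
    (hW : IsAffineOpen W) : Function.Surjective (pb i W) :=
  i.app_surjective W hW

lemma basicOpen_res' {Y : Scheme.{u}} {U V : Y.Opens} (h : V ≤ U) (a : Γ(Y, U)) :
    Y.basicOpen (res h a) = V ⊓ Y.basicOpen a := Y.basicOpen_res a _

lemma pre_basicOpen {Z Y : Scheme.{u}} (i : Z ⟶ Y) {U : Y.Opens} (a : Γ(Y, U)) :
    i ⁻¹ᵁ Y.basicOpen a = Z.basicOpen (pb i U a) := Scheme.preimage_basicOpen i a

lemma pre_inj {Z Y : Scheme.{u}} (i : Z ⟶ Y) (hs : Function.Surjective i) {U V : Y.Opens}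
    (h : i ⁻¹ᵁ U = i ⁻¹ᵁ V) : U = V := by
  ext y
  obtain ⟨z, rfl⟩ := hs y
  exact (SetLike.ext_iff.mp h z)

/-- Given a nbhd of y, W affine with preimage a principal open. -/
lemma exists_nbhd {Z Y : Scheme.{u}} (i : Z ⟶ Y) [IsClosedImmersion i] [IsAffine Z]
    (hs : Function.Surjective i) (y : Y) :
    ∃ (g : Γ(Z, ⊤)) (W : Y.Opens), IsAffineOpen W ∧ i ⁻¹ᵁ W = Z.basicOpen g ∧ y ∈ W := by
  obtain ⟨z, rfl⟩ := hs y
  obtain ⟨U, hU, hyU, -⟩ :=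
      Opens.isBasis_iff_nbhd.mp Y.isBasis_affineOpens (Opens.mem_top (i z))
  obtain ⟨_, ⟨g, rfl⟩, hg, hgU⟩ :=
    Opens.isBasis_iff_nbhd.mp (isBasis_basicOpen Z) (show z ∈ i ⁻¹ᵁ U from hyU)
  obtain ⟨G, hG⟩ := pb_surj i hU (res le_top g)
  have e : i ⁻¹ᵁ Y.basicOpen G = Z.basicOpen g := by
    rw [pre_basicOpen, hG, basicOpen_res']
    exact inf_eq_right.mpr hgU
  exact ⟨g, Y.basicOpen G, IsAffineOpen.basicOpen hU G, e, by
    change z ∈ i ⁻¹ᵁ Y.basicOpen G; rwa [e]⟩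

theorem sqzero_surj {Z Y : Scheme.{u}} (i : Z ⟶ Y) [IsClosedImmersion i] [IsAffine Z]
    [CompactSpace Y] (hs : Function.Surjective i)
    (hsq : ∀ (W : Y.Opens) (a b : Γ(Y, W)), pb i W a = 0 → pb i W b = 0 → a * b = 0)
    (t : Γ(Z, ⊤)) : ∃ τ : Γ(Y, ⊤), pb i ⊤ τ = t := by
  classical
  choose g₀ W₀ hW₀ hg₀ hy₀ using exists_nbhd i hs
  obtain ⟨S, hS⟩ := CompactSpace.elim_nhds_subcover (fun y => (W₀ y : Set Y))
    (fun y => (W₀ y).isOpen.mem_nhds (hy₀ y))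
  let κ := ↥S
  let W : κ → Y.Opens := fun k => W₀ k
  let g : κ → Γ(Z, ⊤) := fun k => g₀ k
  have hW : ∀ k, IsAffineOpen (W k) := fun k => hW₀ k
  have hg : ∀ k, i ⁻¹ᵁ (W k) = Z.basicOpen (g k) := fun k => hg₀ k
  have hcov : iSup W = ⊤ := by
    rw [eq_top_iff]
    intro y _
    have : y ∈ ⋃ x ∈ S, (W₀ x : Set Y) := hS ▸ Set.mem_univ y
    simp only [Set.mem_iUnion] at this
    obtain ⟨x, hx, hyx⟩ := this
    exact Opens.mem_iSup.mpr ⟨⟨x, hx⟩, hyx⟩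
  clear_value W g
  clear hS hg₀ hy₀ hW₀
  have hspan : Ideal.span (Set.range g) = ⊤ := by
    rw [← (isAffineOpen_top Z).self_le_iSup_basicOpen_iff]
    intro z _
    have : i z ∈ iSup W := by rw [hcov]; trivial
    obtain ⟨k, hk⟩ := Opens.mem_iSup.mp this
    refine Opens.mem_iSup.mpr ⟨⟨g k, k, rfl⟩, ?_⟩
    change z ∈ i ⁻¹ᵁ W k at hk
    rwa [hg k] at hk
  -- lifts
  let IsLift : ∀ (V : Y.Opens), Γ(Y, V) → Γ(Z, ⊤) → Prop := fun V G a =>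
    pb i V G = res le_top a
  have lift_res : ∀ {V V' : Y.Opens} (h : V' ≤ V) {G : Γ(Y, V)} {a}, IsLift V G a →
      IsLift V' (res h G) a := by
    intro V V' h G a hG
    change pb i V' _ = _
    rw [pb_res, hG, res_res]
  have lift_mul : ∀ {V : Y.Opens} {G G' : Γ(Y, V)} {a} (e : Γ(Y, V)), IsLift V G a →
      IsLift V G' a → pb i V e = 0 → G * e = G' * e := by
    intro V G G' a e h h' he
    rw [← sub_eq_zero, ← sub_mul]
    exact hsq V _ _ (by rw [map_sub, h, h', sub_self]) he
  have lift_ex : ∀ k a, ∃ G : Γ(Y, W k), IsLift (W k) G a := fun k a => pb_surj i (hW k) _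
  choose tt htt using fun k => lift_ex k t
  let e : ∀ j l, Γ(Y, W j ⊓ W l) := fun j l => res inf_le_left (tt j) - res inf_le_right (tt l)
  have he : ∀ j l, pb i _ (e j l) = 0 := by
    intro j l
    rw [map_sub, lift_res _ (htt j), lift_res _ (htt l), sub_self]
  have pbres0 : ∀ {V V' : Y.Opens} (h : V' ≤ V) {a : Γ(Y, V)}, pb i V a = 0 →
      pb i V' (res h a) = 0 := by
    intro V V' h a ha
    rw [pb_res, ha, map_zero]
  let K : Ideal Γ(Z, ⊤) :=
    { carrier := {a | ∃ x : ∀ j, Γ(Y, W j), (∀ j, pb i _ (x j) = 0) ∧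
        ∀ j l, ∀ G, IsLift (W j ⊓ W l) G a →
          res inf_le_left (x j) - res inf_le_right (x l) = G * e j l}
      zero_mem' := by
        refine ⟨fun _ => 0, fun _ => map_zero _, fun j l G hG => ?_⟩
        rw [map_zero, map_zero, sub_zero]
        exact (hsq _ _ _ (hG.trans (map_zero _)) (he j l)).symm
      add_mem' := by
        rintro a b ⟨x, hx, hx'⟩ ⟨y, hy, hy'⟩
        refine ⟨fun j => x j + y j, fun j => by rw [map_add, hx, hy, add_zero],
          fun j l G hG => ?_⟩
        obtain ⟨A, hA⟩ := lift_ex j a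
        obtain ⟨B, hB⟩ := lift_ex j b
        have hA' := lift_res (inf_le_left : W j ⊓ W l ≤ W j) hA
        have hB' := lift_res (inf_le_left : W j ⊓ W l ≤ W j) hB
        rw [lift_mul (G' := res inf_le_left A + res inf_le_left B) _ hG ?_ (he j l), add_mul,
          ← hx' j l _ hA', ← hy' j l _ hB', map_add, map_add]
        · ring
        · change pb i _ _ = _
          rw [map_add, map_add, hA', hB']
      smul_mem' := by
        rintro a b ⟨x, hx, hx'⟩
        choose A hA using fun j => lift_ex j a
        refine ⟨fun j => A j * x j, fun j => by rw [map_mul, hx, mul_zero],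
          fun j l G hG => ?_⟩
        obtain ⟨B, hB⟩ := lift_ex j b
        have hA' := lift_res (inf_le_left : W j ⊓ W l ≤ W j) (hA j)
        have hA'' := lift_res (inf_le_right : W j ⊓ W l ≤ W l) (hA l)
        have hB' := lift_res (inf_le_left : W j ⊓ W l ≤ W j) hB
        rw [lift_mul (G' := res inf_le_left (A j) * res inf_le_left B) _ hG ?_ (he j l), mul_assoc,
          ← hx' j l _ hB', map_mul, map_mul, lift_mul _ hA'' hA' (pbres0 _ (hx l))]
        · ring
        · change pb i _ _ = _
          rw [map_mul, hA', hB', smul_eq_mul, map_mul] }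
  have hK : K = ⊤ := by
    rw [← Ideal.radical_eq_top, eq_top_iff, ← hspan, Ideal.span_le]
    rintro _ ⟨k, rfl⟩
    choose G hG using fun j => lift_ex j (g k)
    have hbas : ∀ j, W j ⊓ W k = Y.basicOpen (G j) := by
      intro j
      apply pre_inj i hs
      rw [pre_basicOpen, hG j, basicOpen_res', ← hg k]
      rfl
    -- extension
    have h1 : ∀ j, ∃ n, ∀ m, n ≤ m → ∃ y : Γ(Y, W j), pb i _ y = 0 ∧
        res inf_le_left y = res inf_le_left (G j) ^ m * e j k := by
      intro j
      obtain ⟨n, y, hy⟩ := ext_basic (hW j) (G j) (hbas j) inf_le_left (e j k)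
      have : res (pre_le i (inf_le_left : W j ⊓ W k ≤ W j)) (pb i _ y) = 0 := by
        have h := pb_res i (inf_le_left : W j ⊓ W k ≤ W j) y
        rw [hy, map_mul, he, mul_zero] at h
        exact h.symm
      obtain ⟨m, hm⟩ := zero_basic ((hW j).preimage i) (pb i _ (G j))
        (by rw [hbas j, pre_basicOpen]) _ _ this
      refine ⟨n + m, fun r hr => ⟨G j ^ (r - n) * y, ?_, ?_⟩⟩
      · obtain ⟨c, hc⟩ := Nat.exists_eq_add_of_le (show m ≤ r - n by omega)
        rw [hc, pow_add, mul_comm (G j ^ m), mul_assoc, map_mul, map_mul, map_pow _ _ m, hm,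
          mul_zero]
      · rw [map_mul, hy, ← mul_assoc, map_pow, ← pow_add]
        congr 2; omega
    choose n hn using h1
    obtain ⟨N, hN⟩ : ∃ N, ∀ j, n j ≤ N := ⟨Finset.univ.sup n, fun j =>
      Finset.le_sup (Finset.mem_univ j)⟩
    choose y hy0 hy using fun j => hn j N (hN j)
    have hGpow : ∀ j m, IsLift (W j) (G j ^ m) (g k ^ m) := by
      intro j m
      change pb i _ _ = _
      rw [map_pow, map_pow, hG j]
    have h2 : ∀ p : κ × κ, ∃ m, ∀ r, m ≤ r → res (inf_le_left : W p.1 ⊓ W p.2 ≤ _) (G p.1) ^ r *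
        (res inf_le_left (y p.1) - res inf_le_right (y p.2) -
          res inf_le_left (G p.1) ^ N * e p.1 p.2) = 0 := by
      rintro ⟨j, l⟩
      dsimp only
      have haff : IsAffineOpen (W j ⊓ W l) := by
        obtain ⟨H, hH⟩ := lift_ex j (g l)
        have : W j ⊓ W l = Y.basicOpen H := by
          apply pre_inj i hs
          rw [pre_basicOpen, hH, basicOpen_res', ← hg l]
          rfl
        rw [this]
        exact (hW j).basicOpen H
      have := zero_basic haff (res inf_le_left (G j)) (W' := W j ⊓ W l ⊓ W k)
        (by
          rw [basicOpen_res', ← hbas j]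
          apply le_antisymm
          · exact le_inf inf_le_left (le_inf (inf_le_left.trans inf_le_left) inf_le_right)
          · exact le_inf inf_le_left (inf_le_right.trans inf_le_right)) inf_le_left
        (res inf_le_left (y j) - res inf_le_right (y l) -
          res inf_le_left (G j) ^ N * e j l) ?_
      · obtain ⟨m, hm⟩ := this
        refine ⟨m, fun r hr => ?_⟩
        obtain ⟨c, rfl⟩ := Nat.exists_eq_add_of_le hr
        rw [pow_add, mul_comm (_ ^ m), mul_assoc, hm, mul_zero]
      · have a1 : W j ⊓ W l ⊓ W k ≤ W j ⊓ W k :=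
          le_inf (inf_le_left.trans inf_le_left) inf_le_right
        have a2 : W j ⊓ W l ⊓ W k ≤ W l ⊓ W k :=
          le_inf (inf_le_left.trans inf_le_right) inf_le_right
        have b1 := congrArg (res a1) (hy j)
        have b2 := congrArg (res a2) (hy l)
        rw [map_mul, map_pow, res_res, res_res] at b1 b2
        have b3 := lift_mul (G := res (a2.trans inf_le_left) (G l) ^ N)
          (G' := res (a1.trans inf_le_left) (G j) ^ N) (a := g k ^ N) (res a2 (e l k))
          (by rw [← map_pow]; exact lift_res _ (hGpow l N))
          (by rw [← map_pow]; exact lift_res _ (hGpow j N)) (pbres0 _ (he l k))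
        rw [map_sub, map_sub, map_mul, map_pow, res_res, res_res, res_res, b1, b2, b3]
        simp only [e, map_sub, res_res]
        ring
    choose m hm using h2
    obtain ⟨M, hM⟩ : ∃ M, ∀ j, m j ≤ M := ⟨Finset.univ.sup m, fun j =>
      Finset.le_sup (Finset.mem_univ j)⟩
    refine ⟨M + N, fun j => G j ^ M * y j, fun j => by rw [map_mul, hy0, mul_zero],
      fun j l H hH => ?_⟩
    have := hm (j, l) M (hM _)
    dsimp only at this
    have c1 : H * e j l = res inf_le_left (G j) ^ (M + N) * e j l :=
      lift_mul _ hH (by rw [← map_pow]; exact lift_res _ (hGpow j _)) (he j l)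
    have c2 := lift_mul (res (inf_le_right : W j ⊓ W l ≤ W l) (y l))
      (lift_res (inf_le_right : W j ⊓ W l ≤ W l) (hGpow l M))
      (lift_res (inf_le_left : W j ⊓ W l ≤ W j) (hGpow j M)) (pbres0 _ (hy0 l))
    rw [c1, map_mul, map_mul, c2, map_pow, pow_add]
    linear_combination this
  obtain ⟨x, hx0, hx⟩ : (1 : Γ(Z, ⊤)) ∈ K := hK ▸ Submodule.mem_top
  obtain ⟨τ, hτ⟩ := glue W hcov (fun j => tt j - x j) (by
    intro j l
    have := hx j l 1 (by change pb i _ _ = _; rw [map_one, map_one])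
    rw [one_mul] at this
    rw [map_sub, map_sub]
    simp only [e] at this
    linear_combination -this)
  refine ⟨τ, sep (fun j => i ⁻¹ᵁ (W j)) (fun j => le_top) ?_ _ _ ?_⟩
  · intro z _
    have : i z ∈ iSup W := by rw [hcov]; trivial
    obtain ⟨k, hk⟩ := Opens.mem_iSup.mp this
    exact Opens.mem_iSup.mpr ⟨k, hk⟩
  · intro j
    have := pb_res i (le_top : W j ≤ ⊤) τ
    rw [hτ, map_sub, hx0, sub_zero, htt] at this
    exact this.symm




/-- pull back of global sections -/
noncomputable def gpb {Z Y : Scheme.{u}} (i : Z ⟶ Y) : Γ(Y, ⊤) →+* Γ(Z, ⊤) := (i.appTop).hom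

lemma pb_eq_gpb {Z Y : Scheme.{u}} (i : Z ⟶ Y) (a : Γ(Y, ⊤)) : pb i ⊤ a = gpb i a := rfl

lemma gpb_res {Z Y : Scheme.{u}} (i : Z ⟶ Y) (V : Y.Opens) (a : Γ(Y, ⊤)) :
    pb i V (res le_top a) = res le_top (gpb i a) := pb_res i le_top a

lemma pre_basicOpen_top {Z Y : Scheme.{u}} (i : Z ⟶ Y) (a : Γ(Y, ⊤)) :
    i ⁻¹ᵁ Y.basicOpen a = Z.basicOpen (gpb i a) := pre_basicOpen i a

lemma unit_trick {Y Z : Scheme.{u}} (i : Z ⟶ Y) [IsAffine Z]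
    (hsurj : Function.Surjective (gpb i)) (S : Set Γ(Y, ⊤))
    (hS : ∀ z : Z, ∃ s ∈ S, i z ∈ Y.basicOpen s) :
    ∃ u, gpb i u = 0 ∧ 1 - u ∈ Ideal.span S := by
  have h : (Ideal.span S).map (gpb i) = ⊤ := by
    rw [Ideal.map_span]
    refine ((isAffineOpen_top Z).self_le_iSup_basicOpen_iff (s := Set.image (gpb i) S)).mp ?_
    intro z _
    obtain ⟨s, hs, hz⟩ := hS z
    refine Opens.mem_iSup.mpr ⟨⟨_, s, hs, rfl⟩, ?_⟩
    rw [← pre_basicOpen_top i s]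
    exact hz
  have h1 : (1 : Γ(Z, ⊤)) ∈ (Ideal.span S).map (gpb i) := by
    rw [h]; trivial
  rw [Ideal.mem_map_iff_of_surjective _ hsurj] at h1
  obtain ⟨v, hv, hv1⟩ := h1
  exact ⟨1 - v, by rw [map_sub, hv1, map_one, sub_self], by rwa [sub_sub_cancel]⟩

lemma affine_basic {Y : Scheme.{u}} {U : Y.Opens} (hU : IsAffineOpen U) (s : Γ(Y, ⊤))
    (h : Y.basicOpen s ≤ U) : IsAffineOpen (Y.basicOpen s) := by
  have : Y.basicOpen s = Y.basicOpen (res (le_top : U ≤ ⊤) s) := by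
    rw [basicOpen_res', inf_eq_right.mpr h]
  rw [this]
  exact hU.basicOpen _

theorem sqzero_affine {Z Y : Scheme.{u}} (i : Z ⟶ Y) [IsClosedImmersion i] [IsAffine Z]
    [CompactSpace Y] (hs : Function.Surjective i)
    (hsq : ∀ (W : Y.Opens) (a b : Γ(Y, W)), pb i W a = 0 → pb i W b = 0 → a * b = 0) :
    IsAffine Y := by
  have hsurj : Function.Surjective (gpb i) := sqzero_surj i hs hsq
  let S : Set Γ(Y, ⊤) := {s | IsAffineOpen (Y.basicOpen s)}
  refine isAffine_of_isAffineOpen_basicOpen S ?_ fun _ h => h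
  obtain ⟨u, hu0, hu⟩ := unit_trick i hsurj S (by
    intro z
    obtain ⟨U, hU, hyU, -⟩ :=
      Opens.isBasis_iff_nbhd.mp Y.isBasis_affineOpens (Opens.mem_top (i z))
    obtain ⟨_, ⟨g, rfl⟩, hg, hgU⟩ :=
      Opens.isBasis_iff_nbhd.mp (isBasis_basicOpen Z) (show z ∈ i ⁻¹ᵁ U from hyU)
    obtain ⟨s, rfl⟩ := hsurj g
    rw [← pre_basicOpen_top i s] at hg hgU
    refine ⟨s, affine_basic hU s ?_, hg⟩
    intro y hy
    obtain ⟨z, rfl⟩ := hs y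
    exact hgU hy)
  rw [Ideal.eq_top_iff_one]
  have := Ideal.mul_mem_left _ (1 + u) hu
  have h2 := hsq _ u u hu0 hu0
  rwa [show (1 + u) * (1 - u) = 1 by linear_combination -h2] at this

lemma hsq_of_ker {Z Y : Scheme.{u}} (i : Z ⟶ Y) [QuasiCompact i]
    (h : i.ker * i.ker = ⊥) (W : Y.Opens) (a b : Γ(Y, W)) (ha : pb i W a = 0)
    (hb : pb i W b = 0) : a * b = 0 := by
  refine sep (fun U : {U : Y.affineOpens // U.1 ≤ W} => U.1.1) (fun U => U.2) ?_ _ _ ?_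
  · intro y hy
    obtain ⟨U, hU, hyU, hUW⟩ := Opens.isBasis_iff_nbhd.mp Y.isBasis_affineOpens hy
    exact Opens.mem_iSup.mpr ⟨⟨⟨U, hU⟩, hUW⟩, hyU⟩
  · rintro ⟨U, hUW⟩
    have h1 : ∀ c : Γ(Y, W), pb i W c = 0 → res hUW c ∈ i.ker.ideal U := by
      intro c hc
      rw [Scheme.Hom.ker_apply]
      change pb i U.1 _ = 0
      rw [pb_res, hc, map_zero]
    have h2 : res hUW a * res hUW b ∈ (i.ker * i.ker).ideal U :=
      Ideal.mul_mem_mul (h1 a ha) (h1 b hb)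
    rw [h] at h2
    rw [map_mul, map_zero]
    exact h2

lemma pb_comp {Z Y X : Scheme.{u}} (i : Z ⟶ Y) (f : Y ⟶ X) (j : Z ⟶ X) (h : i ≫ f = j)
    (U : X.Opens) (a : Γ(X, U)) : pb j U a = 0 ↔ pb i (f ⁻¹ᵁ U) (pb f U a) = 0 := by
  subst h
  unfold pb
  rw [Scheme.Hom.comp_app]
  rfl

lemma finite_affine_cover (Y : Scheme.{u}) [CompactSpace Y] :
    ∃ S : Finset Y.affineOpens, ⨆ s : S, s.1.1 = ⊤ := by
  obtain ⟨t, ht⟩ := isCompact_univ.elim_finite_subcover (fun U : Y.affineOpens => (U.1 : Set Y))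
    (fun U => U.1.isOpen) (by
      intro y _
      obtain ⟨U, hU, hyU, -⟩ :=
        Opens.isBasis_iff_nbhd.mp Y.isBasis_affineOpens (Opens.mem_top y)
      exact Set.mem_iUnion.mpr ⟨⟨U, hU⟩, hyU⟩)
  refine ⟨t, ?_⟩
  rw [eq_top_iff]
  intro y _
  have := ht (Set.mem_univ y)
  simp only [Set.mem_iUnion] at this
  obtain ⟨U, hU, hy⟩ := this
  exact Opens.mem_iSup.mpr ⟨⟨U, hU⟩, hy⟩

lemma nilradical_pow (Y : Scheme.{u}) [IsNoetherian Y] : ∃ n : ℕ, Y.nilradical ^ (n + 1) = ⊥ := by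
  obtain ⟨S, hS⟩ := finite_affine_cover Y
  have : ∀ U : S, ∃ n, ∀ m, n ≤ m → (Y.nilradical.ideal U.1) ^ m = ⊥ := by
    intro U
    have : IsNoetherianRing Γ(Y, U.1.1) := IsLocallyNoetherian.component_noetherian U.1
    obtain ⟨n, hn⟩ := IsNoetherianRing.isNilpotent_nilradical Γ(Y, U.1.1)
    refine ⟨n, fun m hm => ?_⟩
    have h1 : Y.nilradical.ideal U.1 = nilradical Γ(Y, U.1.1) := rfl
    rw [h1]
    exact pow_eq_zero_of_le hm hn
  choose n hn using this
  refine ⟨Finset.univ.sup n, ?_⟩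
  refine Scheme.IdealSheafData.ext_of_iSup_eq_top (fun s : S => s.1) hS ?_
  intro s
  rw [Scheme.IdealSheafData.ideal_pow]
  exact hn s _ ((Finset.le_sup (Finset.mem_univ s)).trans (Nat.le_succ _))

theorem lemmaN (Y : Scheme.{u}) [IsNoetherian Y] [h : IsAffine Y.nilradical.subscheme] :
    IsAffine Y := by
  have key : ∀ n : ℕ, IsAffine (Y.nilradical ^ (n + 1)).subscheme := by
    intro n
    induction n with
    | zero => 
      have : Y.nilradical ^ (0 + 1) = Y.nilradical := by rw [zero_add, pow_one]
      rw [this]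
      exact h
    | succ n ih =>
      have hle : Y.nilradical ^ (n + 1 + 1) ≤ Y.nilradical ^ (n + 1) := by
        rw [Scheme.IdealSheafData.le_def]
        intro U
        exact Ideal.pow_le_pow_right (Nat.le_succ _)
      set J := Y.nilradical ^ (n + 1 + 1) with hJ
      set I := Y.nilradical ^ (n + 1) with hI
      let i := Scheme.IdealSheafData.inclusion hle
      have hi : i ≫ J.subschemeι = I.subschemeι :=
        Scheme.IdealSheafData.inclusion_subschemeι hle
      have : IsClosedImmersion (i ≫ J.subschemeι) := by rw [hi]; infer_instance
      have hci : IsClosedImmersion i := .of_comp_isClosedImmersion i J.subschemeι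
      have hc : CompactSpace J.subscheme := QuasiCompact.compactSpace_of_compactSpace J.subschemeι
      refine sqzero_affine i ?_ (hsq_of_ker i ?_)
      · intro y
        have h1 : J.subschemeι y ∈ Set.range I.subschemeι := by
          rw [Scheme.IdealSheafData.range_subschemeι, hI,
            Scheme.IdealSheafData.support_pow_succ, Scheme.support_nilradical]
          trivial
        obtain ⟨z, hz⟩ := h1
        refine ⟨z, J.subschemeι.injective ?_⟩
        rw [← hz, ← hi]
        rfl
      · refine Scheme.IdealSheafData.ext_of_iSup_eq_top
          (fun U : Y.affineOpens => ⟨J.subschemeι ⁻¹ᵁ U.1, U.2.preimage _⟩) ?_ ?_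
        · rw [eq_top_iff]
          intro y _
          obtain ⟨U, hU, hyU, -⟩ :=
            Opens.isBasis_iff_nbhd.mp Y.isBasis_affineOpens (Opens.mem_top (J.subschemeι y))
          exact Opens.mem_iSup.mpr ⟨⟨U, hU⟩, hyU⟩
        · intro U
          refine le_antisymm (Ideal.mul_le.mpr ?_) bot_le
          intro c hc d hd
          rw [Scheme.Hom.ker_apply] at hc hd
          obtain ⟨C, rfl⟩ := J.subschemeι_app_surjective U c
          obtain ⟨D, rfl⟩ := J.subschemeι_app_surjective U d
          have hC : C ∈ I.ideal U := by
            rw [← I.ker_subschemeι_app]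
            exact (pb_comp _ _ _ hi _ _).mpr hc
          have hD : D ∈ I.ideal U := by
            rw [← I.ker_subschemeι_app]
            exact (pb_comp _ _ _ hi _ _).mpr hd
          have hCD : C * D ∈ J.ideal U := by
            have : C * D ∈ I.ideal U * I.ideal U := Ideal.mul_mem_mul hC hD
            rw [hI, Scheme.IdealSheafData.ideal_pow, Pi.pow_apply, ← pow_add] at this
            rw [hJ, Scheme.IdealSheafData.ideal_pow, Pi.pow_apply]
            exact Ideal.pow_le_pow_right (by omega) this
          rw [← J.ker_subschemeι_app] at hCD
          rw [← map_mul]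
          exact hCD
  obtain ⟨n, hn⟩ := nilradical_pow Y
  have := key n
  rw [hn] at this
  exact .of_isIso (inv (Scheme.IdealSheafData.subschemeι (⊥ : Y.IdealSheafData)))




/-- The reduced closed subscheme supported on `T`. -/
noncomputable abbrev VT {Y : Scheme.{u}} (T : Closeds Y) : Y.IdealSheafData :=
  Scheme.IdealSheafData.vanishingIdeal T

lemma range_VT {Y : Scheme.{u}} (T : Closeds Y) : Set.range (VT T).subschemeι = T := by
  rw [Scheme.IdealSheafData.range_subschemeι]
  simp

/-- All proper closed subschemes are affine. -/
def ProperAffine (Y : Scheme.{u}) : Prop :=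
  ∀ (V : Scheme.{u}) (i : V ⟶ Y), IsClosedImmersion i → ¬ Function.Surjective i → IsAffine V

lemma ProperAffine.vt {Y : Scheme.{u}} (h : ProperAffine Y) {T : Closeds Y} (hT : T ≠ ⊤) :
    IsAffine (VT T).subscheme := by
  refine h _ (VT T).subschemeι inferInstance ?_
  intro hs
  apply hT
  have := range_VT T
  rw [hs.range_eq] at this
  exact SetLike.coe_injective this.symm

lemma pow_mem_of_basicOpen_le {Y : Scheme.{u}} [CompactSpace Y] [QuasiSeparatedSpace Y]
    (u s : Γ(Y, ⊤)) (h : Y.basicOpen u ≤ Y.basicOpen s) : ∃ n : ℕ, s ∣ u ^ n := by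
  have hunit : IsUnit (res (le_top : Y.basicOpen u ≤ ⊤) s) := by
    have h1 : IsUnit (res (le_top : Y.basicOpen s ≤ ⊤) s) :=
      RingedSpace.isUnit_res_basicOpen Y.toRingedSpace s
    have := h1.map (res h)
    rwa [res_res] at this
  obtain ⟨v, hv⟩ := hunit.exists_right_inv
  obtain ⟨n, y, hy⟩ : ∃ (n : ℕ) (y : Γ(Y, ⊤)), res (le_top : Y.basicOpen u ≤ ⊤) y =
      res (le_top : Y.basicOpen u ≤ ⊤) u ^ n * v :=
    exists_eq_pow_mul_of_isCompact_of_isQuasiSeparated Y ⊤ isCompact_univ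
    isQuasiSeparated_univ u v
  obtain ⟨m, hm⟩ := exists_pow_mul_eq_zero_of_res_basicOpen_eq_zero_of_isCompact Y
    (U := ⊤) isCompact_univ (s * y - u ^ n) u (by
      change res (le_top : Y.basicOpen u ≤ ⊤) _ = 0
      rw [map_sub, map_mul, hy, map_pow]
      linear_combination (res le_top u) ^ n * hv)
  exact ⟨m + n, u ^ m * y, by rw [pow_add]; linear_combination -hm⟩

lemma Opens.exists_affine_nbhd {Y : Scheme.{u}} (y : Y) : ∃ U : Y.Opens, IsAffineOpen U ∧ y ∈ U := by
  obtain ⟨U, hU, hyU, -⟩ :=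
      Opens.isBasis_iff_nbhd.mp Y.isBasis_affineOpens (Opens.mem_top y)
  exact ⟨U, hU, hyU⟩

theorem critC (Y : Scheme.{u}) [CompactSpace Y] [QuasiSeparatedSpace Y]
    (hcl : ProperAffine Y)
    (hext : ∀ T : Closeds Y, T ≠ ⊤ → Function.Surjective (gpb (VT T).subschemeι)) :
    IsAffine Y := by
  by_cases hex : ∃ (y : Y) (U : Y.Opens), IsClosed ({y} : Set Y) ∧ IsAffineOpen U ∧
      (U : Set Y) = {y}
  · obtain ⟨y, U, hy, hU, hUy⟩ := hex
    let U' : Y.Opens := ⟨{y}ᶜ, hy.isOpen_compl⟩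
    have hcl' : IsClosedImmersion U'.ι := by
      refine .of_isPreimmersion _ ?_
      rw [Scheme.Opens.range_ι]
      change IsClosed ({y}ᶜ : Set Y)
      rw [← hUy]
      exact U.isOpen.isClosed_compl
    have haff : IsAffineOpen U' := by
      refine hcl _ U'.ι hcl' fun hs => ?_
      have := hs.range_eq
      rw [Scheme.Opens.range_ι] at this
      have h1 : y ∈ (U' : Set Y) := this ▸ Set.mem_univ y
      exact h1 rfl
    have := hU.sup_of_disjoint haff (by
      rw [← Opens.coe_disjoint, hUy]
      exact disjoint_compl_right)
    have htop : U ⊔ U' = ⊤ := by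
      ext1
      rw [Opens.coe_sup, hUy]
      exact Set.union_compl_self _
    rw [htop] at this
    have h2 : IsAffine (⊤ : Y.Opens) := this
    exact .of_isIso Y.topIso.inv
  push Not at hex
  let S : Set Γ(Y, ⊤) := {s | IsAffineOpen (Y.basicOpen s)}
  refine isAffine_of_isAffineOpen_basicOpen S ?_ fun _ h => h
  have hS : ∀ y : Y, ∃ s ∈ S, y ∈ Y.basicOpen s := by
    intro y'
    obtain ⟨y, hyy', hy⟩ := (isClosed_closure (s := {y'})).exists_closed_singleton
      ⟨y', subset_closure rfl⟩
    obtain ⟨U, hU, hyU⟩ := Opens.exists_affine_nbhd y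
    let T : Closeds Y := ⟨(U : Set Y)ᶜ ∪ {y}, U.isOpen.isClosed_compl.union hy⟩
    have hT : T ≠ ⊤ := by
      intro hT
      apply hex y U hy hU
      apply Set.eq_singleton_iff_unique_mem.mpr ⟨hyU, fun x hx => ?_⟩
      have : x ∈ T := hT ▸ trivial
      rcases this with h | h
      · exact (h hx).elim
      · exact h
    have := hcl.vt hT
    obtain ⟨z, hz⟩ : y ∈ Set.range (VT T).subschemeι := by
      rw [range_VT]; exact Or.inr rfl
    obtain ⟨_, ⟨g, rfl⟩, hg, hgU⟩ :=
      Opens.isBasis_iff_nbhd.mp (isBasis_basicOpen (VT T).subscheme)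
        (show z ∈ (VT T).subschemeι ⁻¹ᵁ U by change (VT T).subschemeι z ∈ U; rwa [hz])
    obtain ⟨s, rfl⟩ := hext T hT g
    rw [← pre_basicOpen_top _ s] at hg hgU
    have hys : y ∈ Y.basicOpen s := by rw [← hz]; exact hg
    refine ⟨s, affine_basic hU s ?_, ?_⟩
    · intro x hx
      by_contra hxU
      obtain ⟨w, rfl⟩ : x ∈ Set.range (VT T).subschemeι := by
        rw [range_VT]; exact Or.inl hxU
      exact hxU (hgU hx)
    · exact (specializes_iff_mem_closure.mpr hyy').mem_open (Y.basicOpen s).isOpen hys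
  rcases isEmpty_or_nonempty Y with hemp | ⟨⟨y₀⟩⟩
  · rw [Ideal.eq_top_iff_one]
    have : Subsingleton Γ(Y, ⊤) := by
      rw [show (⊤ : Y.Opens) = ⊥ from by ext x; exact (hemp.false x).elim]
      infer_instance
    rw [Subsingleton.elim (1 : Γ(Y, ⊤)) 0]
    exact zero_mem _
  obtain ⟨s₀, hs₀, hy₀⟩ := hS y₀
  let T : Closeds Y := ⟨(Y.basicOpen s₀ : Set Y)ᶜ, (Y.basicOpen s₀).isOpen.isClosed_compl⟩
  have hT : T ≠ ⊤ := by
    intro hT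
    have : y₀ ∈ T := hT ▸ trivial
    exact this hy₀
  have := hcl.vt hT
  obtain ⟨v, hv0, hv⟩ := unit_trick (VT T).subschemeι (hext T hT) S (fun z => hS _)
  obtain ⟨n, hn⟩ := pow_mem_of_basicOpen_le v s₀ (by
    intro y hy
    by_contra hys
    obtain ⟨w, rfl⟩ : y ∈ Set.range (VT T).subschemeι := by
      rw [range_VT]; exact hys
    change w ∈ (VT T).subschemeι ⁻¹ᵁ (Y.basicOpen v) at hy
    rw [pre_basicOpen_top, hv0, Scheme.basicOpen_zero] at hy
    exact hy)
  rw [← Ideal.radical_eq_top, Ideal.eq_top_iff_one]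
  have h1 : v ∈ (Ideal.span S).radical := ⟨n, Ideal.mem_of_dvd _ hn (Ideal.subset_span hs₀)⟩
  have := add_mem h1 (Ideal.le_radical hv)
  rwa [add_sub_cancel] at this




lemma gpb_comp {Z Y X : Scheme.{u}} (i : Z ⟶ Y) (f : Y ⟶ X) (j : Z ⟶ X) (h : i ≫ f = j)
    (a : Γ(X, ⊤)) : gpb j a = gpb i (gpb f a) := by
  subst h
  unfold gpb
  rw [Scheme.Hom.comp_appTop]
  rfl

lemma pb_lift {Z Y X : Scheme.{u}} (i : Z ⟶ Y) (f : Y ⟶ X) (j : Z ⟶ X) (h : i ≫ f = j)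
    (U : X.Opens) (a : Γ(X, U)) (t : Γ(Y, ⊤)) (ha : pb f U a = res le_top t) :
    pb j U a = res le_top (gpb i t) := by
  subst h
  have h1 : pb (i ≫ f) U a = pb i (f ⁻¹ᵁ U) (pb f U a) := by
    unfold pb
    rw [Scheme.Hom.comp_app]
    rfl
  rw [h1, ha]
  exact gpb_res i (f ⁻¹ᵁ U) t

lemma gpb_surj {Z Y : Scheme.{u}} (i : Z ⟶ Y) [IsClosedImmersion i] [IsAffine Y] :
    Function.Surjective (gpb i) := pb_surj i (isAffineOpen_top Y)

lemma sub_mem_ideal {Y : Scheme.{u}} (I : Y.IdealSheafData) (U : Y.affineOpens) (a b : Γ(Y, U.1))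
    (h : pb I.subschemeι U a = pb I.subschemeι U b) : a - b ∈ I.ideal U := by
  rw [← I.ker_subschemeι_app]
  change pb I.subschemeι U (a - b) = 0
  rw [map_sub, h, sub_self]

lemma pb_eq_zero {Y : Scheme.{u}} (I : Y.IdealSheafData) (U : Y.affineOpens) (a : Γ(Y, U.1))
    (h : a ∈ I.ideal U) : pb I.subschemeι U a = 0 := by
  rw [← I.ker_subschemeι_app] at h
  exact h

lemma inclusion_closed {Y : Scheme.{u}} {I J : Y.IdealSheafData} (h : I ≤ J) :
    IsClosedImmersion (Scheme.IdealSheafData.inclusion h) := by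
  have : IsClosedImmersion (Scheme.IdealSheafData.inclusion h ≫ I.subschemeι) := by
    rw [Scheme.IdealSheafData.inclusion_subschemeι]; infer_instance
  exact .of_comp_isClosedImmersion _ I.subschemeι

lemma iSup_affine (Y : Scheme.{u}) : ⨆ U : Y.affineOpens, U.1 = ⊤ := by
  rw [eq_top_iff]
  intro y _
  obtain ⟨U, hU, hy⟩ := Opens.exists_affine_nbhd y
  exact Opens.mem_iSup.mpr ⟨⟨U, hU⟩, hy⟩

lemma eq_of_cover {Z Y : Scheme.{u}} (i : Z ⟶ Y) {κ : Type*} (U : κ → Y.Opens) (hU : iSup U = ⊤)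
    (t t' : Γ(Z, ⊤)) (h : ∀ k, res (le_top : i ⁻¹ᵁ U k ≤ ⊤) t = res le_top t') : t = t' := by
  refine sep (fun k => i ⁻¹ᵁ (U k)) (fun _ => le_top) ?_ _ _ h
  intro z _
  have : i z ∈ iSup U := by rw [hU]; trivial
  obtain ⟨k, hk⟩ := Opens.mem_iSup.mp this
  exact Opens.mem_iSup.mpr ⟨k, hk⟩

lemma basicOpen_of_pb_zero {Z Y : Scheme.{u}} (i : Z ⟶ Y) (W : Y.Opens) (d : Γ(Y, W))
    (h : pb i W d = 0) (z : Z) : i z ∉ Y.basicOpen d := by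
  intro hz
  change z ∈ i ⁻¹ᵁ (Y.basicOpen d) at hz
  rw [pre_basicOpen, h, Scheme.basicOpen_zero] at hz
  exact hz

theorem lemmaG {Y : Scheme.{u}} [IsReduced Y] (T T' : Closeds Y) (h : T ⊔ T' = ⊤)
    (hT' : IsAffine (VT T').subscheme) : Function.Surjective (gpb (VT T).subschemeι) := by
  intro t
  have hK := inclusion_closed (le_sup_right : VT T' ≤ VT T ⊔ VT T')
  have e := Scheme.IdealSheafData.inclusion_subschemeι (le_sup_left : VT T ≤ VT T ⊔ VT T')
  have e' := Scheme.IdealSheafData.inclusion_subschemeι (le_sup_right : VT T' ≤ VT T ⊔ VT T')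
  set iK := Scheme.IdealSheafData.inclusion (le_sup_left : VT T ≤ VT T ⊔ VT T')
  set i' := Scheme.IdealSheafData.inclusion (le_sup_right : VT T' ≤ VT T ⊔ VT T')
  obtain ⟨t', ht'⟩ := gpb_surj i' (gpb iK t)
  have hloc : ∀ U : Y.affineOpens, ∃ a : Γ(Y, U.1), pb (VT T).subschemeι U a = res le_top t ∧
      pb (VT T').subschemeι U a = res le_top t' := by
    intro U
    obtain ⟨a, ha⟩ := pb_surj (VT T).subschemeι U.2 (res le_top t)
    obtain ⟨a', ha'⟩ := pb_surj (VT T').subschemeι U.2 (res le_top t')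
    have h1 := pb_lift iK _ _ e U.1 a t ha
    have h2 := pb_lift i' _ _ e' U.1 a' t' ha'
    rw [ht', ← h1] at h2
    have h3 := sub_mem_ideal _ U _ _ h2.symm
    rw [Scheme.IdealSheafData.ideal_sup] at h3
    obtain ⟨c, hc, c', hc', hcc⟩ := Submodule.mem_sup.mp h3
    refine ⟨a - c, ?_, ?_⟩
    · rw [map_sub, pb_eq_zero _ U c hc, ha, sub_zero]
    · rw [show a - c = a' + c' by linear_combination -hcc, map_add, ha', pb_eq_zero _ U c' hc',
        add_zero]
  choose a ha ha' using hloc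
  obtain ⟨τ, hτ⟩ := glue (fun U : Y.affineOpens => U.1) (iSup_affine Y) a (by
    intro U V
    rw [← sub_eq_zero, ← basicOpen_eq_bot_iff]
    ext y
    refine iff_of_false (fun hy => ?_) id
    have : y ∈ T ⊔ T' := by rw [h]; trivial
    rcases this with hyT | hyT
    · rw [← range_VT] at hyT
      obtain ⟨z, rfl⟩ := hyT
      refine basicOpen_of_pb_zero _ _ _ ?_ z hy
      rw [map_sub, pb_res, pb_res, ha, ha, res_res, res_res, sub_self]
    · rw [← range_VT] at hyT
      obtain ⟨z, rfl⟩ := hyT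
      refine basicOpen_of_pb_zero _ _ _ ?_ z hy
      rw [map_sub, pb_res, pb_res, ha', ha', res_res, res_res, sub_self])
  refine ⟨τ, eq_of_cover (VT T).subschemeι _ (iSup_affine Y) _ _ fun U => ?_⟩
  rw [← gpb_res, hτ, ha]

theorem ext_reducible {Y : Scheme.{u}} [IsReduced Y] (hcl : ProperAffine Y) (T₁ T₂ : Closeds Y)
    (h₁ : T₁ ≠ ⊤) (h₂ : T₂ ≠ ⊤) (h : T₁ ⊔ T₂ = ⊤) (T : Closeds Y) :
    Function.Surjective (gpb (VT T).subschemeι) := by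
  by_cases hT1 : T ⊔ T₁ = ⊤
  · exact lemmaG T T₁ hT1 (hcl.vt h₁)
  · intro t
    have := hcl.vt hT1
    have hle : VT (T ⊔ T₁) ≤ VT T := Scheme.IdealSheafData.vanishingIdeal_antimono le_sup_left
    have := inclusion_closed hle
    obtain ⟨t₁, ht₁⟩ := gpb_surj (Scheme.IdealSheafData.inclusion hle) t
    obtain ⟨τ, hτ⟩ := lemmaG (T ⊔ T₁) T₂ (by rw [sup_assoc, h, sup_top_eq]) (hcl.vt h₂) t₁
    refine ⟨τ, ?_⟩
    rw [gpb_comp _ _ _ (Scheme.IdealSheafData.inclusion_subschemeι hle), hτ, ht₁]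




lemma algA {K L : Type*} [Field K] [Field L] [Algebra K L] [Algebra.IsAlgebraic K L]
    {κ : Type*} [Fintype κ] (A : κ → Subring K) (B : Subring L) (Bk : κ → Subring L)
    (hA : ∀ k (x : K), ∃ b ∈ A k, b ≠ 0 ∧ b * x ∈ A k)
    (hB : ∀ x : L, ∃ b ∈ B, b ≠ 0 ∧ b * x ∈ B)
    (hBk : ∀ k, B ≤ Bk k)
    (hG : ∀ k, ∃ G : Finset L, ∀ b ∈ Bk k, ∃ c : L → K, (∀ g, c g ∈ A k) ∧
      b = ∑ g ∈ G, c g • g) :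
    ∃ φ : L →ₗ[K] K, φ 1 ≠ 0 ∧ ∀ k, ∀ b ∈ Bk k, φ b ∈ A k := by
  classical
  obtain ⟨ψ, hψ⟩ : ∃ ψ : L →ₗ[K] K, ψ 1 ≠ 0 := by
    by_contra! h
    exact one_ne_zero ((Module.forall_dual_apply_eq_zero_iff K (1 : L)).mp h)
  have hd : ∀ k, ∃ d ∈ A k, d ≠ 0 ∧ ∀ b ∈ Bk k, ψ (d • b) ∈ A k := by
    intro k
    obtain ⟨G, hG⟩ := hG k
    have h1 : ∃ d ∈ A k, d ≠ 0 ∧ ∀ g ∈ G, d * ψ g ∈ A k := by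
      clear hG
      induction G using Finset.induction_on with
      | empty => exact ⟨1, one_mem _, one_ne_zero, by simp⟩
      | insert a s ha ih =>
        obtain ⟨d, hd, hd0, h⟩ := ih
        obtain ⟨b, hb, hb0, h'⟩ := hA k (ψ a)
        refine ⟨d * b, mul_mem hd hb, mul_ne_zero hd0 hb0, ?_⟩
        intro g hg
        rcases Finset.mem_insert.mp hg with rfl | hg
        · rw [mul_assoc]; exact mul_mem hd h'
        · rw [mul_comm d, mul_assoc]; exact mul_mem hb (h g hg)
    obtain ⟨d, hd, hd0, h⟩ := h1
    refine ⟨d, hd, hd0, fun b hb => ?_⟩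
    obtain ⟨c, hc, rfl⟩ := hG b hb
    rw [map_smul, map_sum, Finset.smul_sum]
    refine sum_mem fun g hg => ?_
    rw [map_smul, smul_eq_mul, smul_eq_mul, mul_left_comm]
    exact mul_mem (hc g) (h g hg)
  choose d hd hd0 hdψ using hd
  choose p hp hp0 hpd using fun k => hB (algebraMap K L (d k))⁻¹
  let b₀ := ∏ k, p k
  have hb₀ : b₀ ∈ B := prod_mem fun k _ => hp k
  have hb₀0 : b₀ ≠ 0 := Finset.prod_ne_zero_iff.mpr fun k _ => hp0 k
  have hb : ∀ k, ∃ c ∈ B, b₀ = d k • c := by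
    intro k
    refine ⟨(p k * (algebraMap K L (d k))⁻¹) * ∏ j ∈ Finset.univ.erase k, p j,
      mul_mem (hpd k) (prod_mem fun k _ => hp k), ?_⟩
    have h0 : algebraMap K L (d k) ≠ 0 := by simpa using hd0 k
    rw [Algebra.smul_def]
    change ∏ k, p k = _
    rw [← Finset.mul_prod_erase Finset.univ p (Finset.mem_univ k)]
    field_simp
  have hmem : ∀ k, ∀ b ∈ Bk k, ψ (b₀ * b) ∈ A k := by
    intro k b hbk
    obtain ⟨c, hc, h⟩ := hb k
    rw [h, smul_mul_assoc]
    exact hdψ k _ (mul_mem (hBk k hc) hbk)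
  have hc : ∃ c ∈ B, ψ (b₀ * c) ≠ 0 := by
    by_contra! h
    have h1 : b₀⁻¹ ∈ Algebra.adjoin K (B : Set L) := by
      have : b₀ ∈ Algebra.adjoin K (B : Set L) := Algebra.subset_adjoin hb₀
      exact Subalgebra.inv_mem_of_algebraic (x := ⟨b₀, this⟩) _
        (Algebra.IsAlgebraic.isAlgebraic _)
    rw [← Subalgebra.mem_toSubmodule, Algebra.adjoin_eq_span] at h1
    have h2 : (Submonoid.closure (B : Set L) : Set L) = B :=
      congrArg SetLike.coe (Submonoid.closure_eq B.toSubmonoid)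
    rw [h2] at h1
    have h3 : Submodule.span K (B : Set L) ≤
        LinearMap.ker (ψ ∘ₗ LinearMap.mulLeft K b₀) := by
      rw [Submodule.span_le]
      intro c hc
      exact h c hc
    have h4 : ψ (b₀ * b₀⁻¹) = 0 := h3 h1
    rw [mul_inv_cancel₀ hb₀0] at h4
    exact hψ h4
  obtain ⟨c, hcB, hc⟩ := hc
  refine ⟨ψ ∘ₗ LinearMap.mulLeft K (b₀ * c), ?_, ?_⟩
  · simpa using hc
  · intro k b hb
    simp only [LinearMap.comp_apply, LinearMap.mulLeft_apply]
    rw [mul_assoc]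
    exact hmem k _ (mul_mem (hBk k hcB) hb)

lemma algA' {K L : Type*} [CommRing K] [CommRing L] (hK : IsField K) (hL : IsField L)
    (σ : K →+* L) {κ : Type*} [Fintype κ] [Nonempty κ] (A B : κ → Type*) [∀ k, CommRing (A k)]
    [∀ k, CommRing (B k)] (C : Type*) [CommRing C] (α : ∀ k, A k →+* K) (β : ∀ k, B k →+* L)
    (γ : C →+* L) (ρ : ∀ k, C →+* B k) (hρ : ∀ k c, β k (ρ k c) = γ c)
    (ff : ∀ k, A k →+* B k) (hf : ∀ k a, β k (ff k a) = σ (α k a)) (hfin : ∀ k, (ff k).Finite)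
    (hA : ∀ k (x : K), ∃ b a : A k, α k b ≠ 0 ∧ α k b * x = α k a)
    (hB : ∀ x : L, ∃ b a : C, γ b ≠ 0 ∧ γ b * x = γ a) :
    ∃ φ : L →+ K, (∀ x y, φ (σ x * y) = x * φ y) ∧ φ 1 ≠ 0 ∧ ∀ k b, ∃ a, φ (β k b) = α k a := by
  classical
  letI := hK.toField
  letI := hL.toField
  letI := σ.toAlgebra
  have halg : Algebra.IsAlgebraic K L := by
    obtain ⟨k⟩ := ‹Nonempty κ›
    have hC : ∀ c : C, IsAlgebraic K (γ c) := by
      intro c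
      apply IsIntegral.isAlgebraic
      have h1 : (ff k).IsIntegralElem (ρ k c) := (hfin k).to_isIntegral _
      obtain ⟨p, hp, hp0⟩ := h1
      refine ⟨p.map (α k), hp.map _, ?_⟩
      rw [Polynomial.eval₂_map, ← hρ k]
      have : (algebraMap K L).comp (α k) = (β k).comp (ff k) := by
        ext a; exact (hf k a).symm
      rw [this, ← Polynomial.hom_eval₂, hp0, map_zero]
    refine ⟨fun x => ?_⟩
    obtain ⟨b, a, hb, h⟩ := hB x
    have : x = (γ b)⁻¹ * γ a := by
      rw [← h, ← mul_assoc, inv_mul_cancel₀ hb, one_mul]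
    rw [this]
    exact (hC b).inv.mul (hC a)
  obtain ⟨φ, h1, h2⟩ := algA (K := K) (L := L) (fun k => (α k).range) γ.range
    (fun k => (β k).range)
    (fun k x => by
      obtain ⟨b, a, hb, h⟩ := hA k x
      exact ⟨α k b, ⟨b, rfl⟩, hb, a, h.symm⟩)
    (fun x => by
      obtain ⟨b, a, hb, h⟩ := hB x
      exact ⟨γ b, ⟨b, rfl⟩, hb, a, h.symm⟩)
    (fun k => by
      rintro _ ⟨c, rfl⟩
      exact ⟨ρ k c, hρ k c⟩)
    (fun k => by
      letI := (ff k).toAlgebra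
      obtain ⟨G, hG⟩ : (⊤ : Submodule (A k) (B k)).FG := (hfin k).fg_top
      refine ⟨G.image (β k), ?_⟩
      rintro _ ⟨b, rfl⟩
      have hb : b ∈ Submodule.span (A k) (G : Set (B k)) := by rw [hG]; trivial
      induction hb using Submodule.span_induction with
      | mem x hx =>
        refine ⟨fun g => if g = β k x then 1 else 0, fun g => ?_, ?_⟩
        · dsimp only
          split_ifs
          · exact one_mem _
          · exact zero_mem _
        · simp only [ite_smul, one_smul, zero_smul]
          rw [Finset.sum_ite_eq', if_pos (Finset.mem_image_of_mem _ hx)]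
      | zero => exact ⟨0, fun g => zero_mem _, by simp⟩
      | add x y _ _ hx hy =>
        obtain ⟨c, hc, hx⟩ := hx
        obtain ⟨c', hc', hy⟩ := hy
        refine ⟨c + c', fun g => add_mem (hc g) (hc' g), ?_⟩
        rw [map_add, hx, hy, ← Finset.sum_add_distrib]
        simp only [Pi.add_apply, add_smul]
      | smul a x _ hx =>
        obtain ⟨c, hc, hx⟩ := hx
        refine ⟨fun g => α k a * c g, fun g => mul_mem ⟨a, rfl⟩ (hc g), ?_⟩
        rw [show a • x = ff k a * x from Algebra.smul_def a x, map_mul, hf, hx, Finset.mul_sum]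
        refine Finset.sum_congr rfl fun g _ => ?_
        rw [mul_smul]
        exact (Algebra.smul_def (α k a) (c g • g)).symm)
  refine ⟨φ.toAddMonoidHom, fun x y => ?_, h1, fun k b => ?_⟩
  · have := φ.map_smul x y
    rw [Algebra.smul_def] at this
    exact this
  · obtain ⟨a, ha⟩ := h2 k _ ⟨b, rfl⟩
    exact ⟨a, ha.symm⟩




lemma ker_fromSpec {X : Scheme.{u}} {V : X.Opens} (hV : IsAffineOpen V) {R : CommRingCat.{u}}
    (q : Γ(X, V) ⟶ R) (c : Γ(X, V)) (hc : (Spec.map q ≫ hV.fromSpec).app V c = 0) : q c = 0 := by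
  have e : (Spec.map q ≫ hV.fromSpec).app V = q ≫ (Scheme.ΓSpecIso R).inv ≫
      (Spec R).presheaf.map (eqToHom (show Spec.map q ⁻¹ᵁ hV.fromSpec ⁻¹ᵁ V = ⊤ by
        rw [hV.fromSpec_preimage_self]; rfl)).op := by
    rw [Scheme.Hom.comp_app, hV.fromSpec_app_self, Category.assoc, Scheme.Hom.naturality]
    exact ((Category.assoc _ _ _).symm.trans (congrArg (fun z => z ≫ (Spec R).presheaf.map _)
      (Scheme.ΓSpecIso_inv_naturality q).symm)).trans (Category.assoc _ _ _)
  rw [e] at hc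
  have hinj : Function.Injective ((Scheme.ΓSpecIso R).inv ≫
      (Spec R).presheaf.map (eqToHom (show Spec.map q ⁻¹ᵁ hV.fromSpec ⁻¹ᵁ V = ⊤ by
        rw [hV.fromSpec_preimage_self]; rfl)).op) :=
    (ConcreteCategory.bijective_of_isIso _).1
  apply hinj
  rw [map_zero]
  exact hc

lemma comap_ideal_le {X Y : Scheme.{u}} (f : X ⟶ Y) [IsAffineHom f] (I : Y.IdealSheafData)
    (U : Y.affineOpens) (hV : IsAffineOpen (f ⁻¹ᵁ U.1)) :
    (I.comap f).ideal ⟨f ⁻¹ᵁ U.1, hV⟩ ≤ (I.ideal U).map (pb f U.1) := by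
  let q : Γ(X, f ⁻¹ᵁ U.1) ⟶ CommRingCat.of (Γ(X, f ⁻¹ᵁ U.1) ⧸ (I.ideal U).map (pb f U.1)) :=
    CommRingCat.ofHom (Ideal.Quotient.mk _)
  let l : CommRingCat.of (Γ(Y, U.1) ⧸ I.ideal U) ⟶
      CommRingCat.of (Γ(X, f ⁻¹ᵁ U.1) ⧸ (I.ideal U).map (pb f U.1)) :=
    CommRingCat.ofHom (Ideal.quotientMap _ (pb f U.1) Ideal.le_comap_map)
  have hl : CommRingCat.ofHom (Ideal.Quotient.mk (I.ideal U)) ≫ l = f.app U.1 ≫ q := by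
    ext x
    rfl
  let j := Spec.map q ≫ hV.fromSpec
  let c : Spec (CommRingCat.of (Γ(Y, U.1) ⧸ I.ideal U)) ⟶ I.subscheme := I.subschemeCover.f U
  have h2 : c ≫ I.subschemeι =
      Spec.map (CommRingCat.ofHom (Ideal.Quotient.mk (I.ideal U))) ≫ U.2.fromSpec :=
    (I.subschemeCover_map_subschemeι U).trans (I.glueDataObjι_ι U)
  have hjf : j ≫ f = (Spec.map l ≫ c) ≫ I.subschemeι := by
    have h1 := IsAffineOpen.SpecMap_appLE_fromSpec f U.2 hV le_rfl
    rw [Scheme.Hom.appLE_eq_app] at h1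
    have h3 : (Spec.map l ≫ c) ≫ I.subschemeι = Spec.map l ≫
        Spec.map (CommRingCat.ofHom (Ideal.Quotient.mk (I.ideal U))) ≫ U.2.fromSpec := by
      rw [Category.assoc, h2]
    have h4 : j ≫ f = Spec.map q ≫ Spec.map (f.app U.1) ≫ U.2.fromSpec := by
      rw [h1]
      exact Category.assoc _ _ _
    rw [h3, h4, ← Spec.map_comp_assoc, ← Spec.map_comp_assoc, hl]
  have hle : I.comap f ≤ j.ker := by
    rw [← Scheme.IdealSheafData.le_map_iff_comap_le, Scheme.IdealSheafData.map_ker, hjf]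
    exact (I.ker_subschemeι).ge.trans (Scheme.Hom.le_ker_comp _ _)
  intro c hc
  have h1 := j.ideal_ker_le ⟨f ⁻¹ᵁ U.1, hV⟩ (hle _ hc)
  have h2 := ker_fromSpec hV q c h1
  exact Ideal.Quotient.eq_zero_iff_mem.mp h2

/-- germ as ring hom -/
noncomputable def gm {Y : Scheme.{u}} (U : Y.Opens) (y : Y) (hy : y ∈ U) :
    Γ(Y, U) →+* Y.presheaf.stalk y := (Y.presheaf.germ U y hy).hom

lemma gm_res {Y : Scheme.{u}} {U V : Y.Opens} (h : V ≤ U) (y : Y) (hy : y ∈ V) (a : Γ(Y, U)) :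
    gm V y hy (res h a) = gm U y (h hy) a :=
  Y.presheaf.germ_res_apply (homOfLE h) y hy a

lemma gm_inj {Y : Scheme.{u}} [IsIntegral Y] (U : Y.Opens) (y : Y) (hy : y ∈ U) :
    Function.Injective (gm U y hy) := germ_injective_of_isIntegral Y y hy

lemma gm_frac {Y : Scheme.{u}} {U : Y.Opens} (hU : IsAffineOpen U) (y : Y) (hy : y ∈ U)
    [Nontrivial (Y.presheaf.stalk y)]
    (x : Y.presheaf.stalk y) : ∃ b a, gm U y hy b ≠ 0 ∧ gm U y hy b * x = gm U y hy a := by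
  let := Y.presheaf.algebra_section_stalk ⟨y, hy⟩
  have := hU.isLocalization_stalk ⟨y, hy⟩
  obtain ⟨⟨a, b⟩, h⟩ := IsLocalization.surj (hU.primeIdealOf ⟨y, hy⟩).asIdeal.primeCompl x
  refine ⟨b, a, ?_, ?_⟩
  · exact (IsLocalization.map_units (Y.presheaf.stalk y) b).ne_zero
  · rw [mul_comm]; exact h

lemma gm_pb {X Y : Scheme.{u}} (f : X ⟶ Y) (U : Y.Opens) (x : X) (hx : f x ∈ U) (a : Γ(Y, U)) :
    gm (f ⁻¹ᵁ U) x hx (pb f U a) = (f.stalkMap x).hom (gm U (f x) hx a) :=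
  (f.germ_stalkMap_apply U x hx a).symm

lemma glue_stalk {Y : Scheme.{u}} [IsIntegral Y] {κ : Type*} (U : κ → Y.Opens) (hU : iSup U = ⊤)
    (y : Y) (hy : ∀ k, y ∈ U k) (r : Y.presheaf.stalk y) (a : ∀ k, Γ(Y, U k))
    (ha : ∀ k, gm (U k) y (hy k) (a k) = r) :
    ∃ R : Γ(Y, ⊤), ∀ k, res le_top R = a k := by
  refine glue U hU a ?_
  intro k l
  have hkl : y ∈ U k ⊓ U l := ⟨hy k, hy l⟩
  apply gm_inj (U k ⊓ U l) y hkl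
  rw [gm_res, gm_res, ha, ha]

lemma cover_nonempty (Y : Scheme.{u}) [CompactSpace Y] :
    ∃ S : Finset Y.affineOpens, (∀ U ∈ S, (U.1 : Set Y).Nonempty) ∧ ⨆ s : S, s.1.1 = ⊤ := by
  classical
  obtain ⟨S, hS⟩ := finite_affine_cover Y
  refine ⟨S.filter (fun U => (U.1 : Set Y).Nonempty), fun U hU => (Finset.mem_filter.mp hU).2, ?_⟩
  rw [eq_top_iff]
  intro y _
  have : y ∈ ⨆ s : S, s.1.1 := by rw [hS]; trivial
  obtain ⟨k, hk⟩ := Opens.mem_iSup.mp this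
  exact Opens.mem_iSup.mpr ⟨⟨k.1, Finset.mem_filter.mpr ⟨k.2, ⟨y, hk⟩⟩⟩, hk⟩

lemma isField_generic (X : Scheme.{u}) [IsIntegral X] (x : X) (hx : x = genericPoint X) :
    IsField (X.presheaf.stalk x) := by
  subst hx
  exact Field.toIsField X.functionField

theorem ext_integral {X Y : Scheme.{u}} [IsIntegral X] [IsAffine X] [IsIntegral Y] [CompactSpace Y]
    (f : X ⟶ Y) [IsFinite f] (hf : Function.Surjective f) (hcl : ProperAffine Y)
    (T : Closeds Y) (hT : T ≠ ⊤) :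
    Function.Surjective (gpb (VT T).subschemeι) := by
  classical
  intro t
  let x : X := genericPoint X
  have hy : IsGenericPoint (f x) (Set.univ : Set Y) := by
    have := (genericPoint_spec X).image f.continuous
    rwa [Set.image_univ, hf.range_eq, closure_univ] at this
  have hL := isField_generic X x rfl
  have hK := isField_generic Y (f x) (hy.eq (genericPoint_spec Y))
  obtain ⟨S, hSne, hS⟩ := cover_nonempty Y
  have hm : ∀ s : S, f x ∈ s.1.1 := fun s =>
    (hy.mem_open_set_iff s.1.1.isOpen).mpr (by simpa using hSne s.1 s.2)
  have : Nonempty S := by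
    by_contra hem
    rw [not_nonempty_iff] at hem
    have : f x ∈ ⨆ s : S, s.1.1 := by rw [hS]; trivial
    obtain ⟨k, hk⟩ := Opens.mem_iSup.mp this
    exact hem.false k
  have := hK.nontrivial
  have := hL.nontrivial
  obtain ⟨φ, hφσ, hφ1, hφ⟩ := algA' hK hL (f.stalkMap x).hom
    (fun s : S => Γ(Y, s.1.1)) (fun s : S => Γ(X, f ⁻¹ᵁ s.1.1)) Γ(X, ⊤)
    (fun s => gm s.1.1 (f x) (hm s)) (fun s => gm (f ⁻¹ᵁ s.1.1) x (hm s))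
    (gm ⊤ x trivial) (fun s => res le_top) (fun s c => gm_res _ _ _ _)
    (fun s => pb f s.1.1) (fun s a => gm_pb f _ _ _ _) (fun s => f.finite_app _ s.1.2)
    (fun s z => gm_frac s.1.2 _ _ z) (fun z => gm_frac (isAffineOpen_top X) _ _ z)
  -- the section `s`
  have h1 : ∀ k : S, ∃ a, gm k.1.1 (f x) (hm k) a = φ 1 := by
    intro k
    obtain ⟨a, ha⟩ := hφ k 1
    rw [map_one] at ha
    exact ⟨a, ha.symm⟩
  choose sk hsk using h1
  obtain ⟨s, hs⟩ := glue_stalk (fun k : S => k.1.1) hS (f x) hm (φ 1) sk hsk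
  have hsg : gm ⊤ (f x) trivial s = φ 1 := by
    obtain ⟨k⟩ := ‹Nonempty S›
    rw [← hsk k, ← hs k, gm_res]
  let J := VT T
  let I : Y.IdealSheafData := Scheme.IdealSheafData.ofIdealTop (Ideal.span {s}) * J
  have hI : ∀ U : Y.affineOpens, I.ideal U = Ideal.span {res le_top s} * J.ideal U := by
    intro U
    change Ideal.map (res le_top) (Ideal.span {s}) * J.ideal U = _
    rw [Ideal.map_span, Set.image_singleton]
  have hIJ : I ≤ J := by
    rw [Scheme.IdealSheafData.le_def]
    intro U
    rw [hI]
    exact Ideal.mul_le_right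
  have hIaff : IsAffine I.subscheme := by
    refine hcl _ I.subschemeι inferInstance fun hsur => hT ?_
    have h1 : I = ⊥ := by
      rw [← Scheme.IdealSheafData.support_eq_top_iff]
      apply SetLike.coe_injective
      rw [← I.range_subschemeι, hsur.range_eq]
      rfl
    have h2 : J = ⊥ := by
      refine Scheme.IdealSheafData.ext_of_iSup_eq_top (fun k : S => k.1) hS ?_
      intro k
      refine le_antisymm ?_ bot_le
      intro a ha
      have h3 : res le_top s * a ∈ I.ideal k.1 := by
        rw [hI]
        exact Ideal.mul_mem_mul (Ideal.mem_span_singleton_self _) ha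
      rw [h1] at h3
      have h4 : res le_top s * a = 0 := h3
      have h5 := congrArg (gm k.1.1 (f x) (hm k)) h4
      rw [map_mul, map_zero, gm_res, hsg] at h5
      obtain ⟨v, hv⟩ := hK.mul_inv_cancel hφ1
      change a = 0
      apply gm_inj k.1.1 (f x) (hm k)
      rw [map_zero]
      linear_combination v * h5 - gm k.1.1 (f x) (hm k) a * hv
    have h3 : J.support = T := SetLike.coe_injective ((J.range_subschemeι).symm.trans (range_VT T))
    rw [← h3, h2]
    rfl
  have := inclusion_closed hIJ
  have einc := Scheme.IdealSheafData.inclusion_subschemeι hIJ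
  obtain ⟨t', ht'⟩ := gpb_surj (Scheme.IdealSheafData.inclusion hIJ) t
  let m := Scheme.IdealSheafData.subschemeMap (I.comap f) I f (I.le_map_comap f)
  have em : m ≫ I.subschemeι = (I.comap f).subschemeι ≫ f :=
    Scheme.IdealSheafData.subschemeMap_subschemeι _ _ _ _
  obtain ⟨b, hb⟩ := gpb_surj (I.comap f).subschemeι (gpb m t')
  choose tk htk using fun k : S => pb_surj I.subschemeι k.1.2 (res le_top t')
  have hmem : ∀ k : S, res le_top b - pb f k.1.1 (tk k) ∈ (I.ideal k.1).map (pb f k.1.1) := by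
    intro k
    have hV : IsAffineOpen (f ⁻¹ᵁ k.1.1) := k.1.2.preimage f
    apply comap_ideal_le f I k.1 hV
    apply sub_mem_ideal
    have h1 := pb_lift m _ _ em k.1.1 (tk k) t' (htk k)
    have h2 := gpb_res (I.comap f).subschemeι (f ⁻¹ᵁ k.1.1) b
    rw [hb] at h2
    refine h2.trans (Eq.trans h1.symm ?_)
    unfold pb
    rw [Scheme.Hom.comp_app]
    rfl
  obtain ⟨v, hv⟩ := hK.mul_inv_cancel hφ1
  have hred : ∀ (k : S), ∀ c ∈ (I.ideal k.1).map (pb f k.1.1), ∀ d : Γ(X, f ⁻¹ᵁ k.1.1),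
      ∃ e ∈ J.ideal k.1, φ (gm (f ⁻¹ᵁ k.1.1) x (hm k) (d * c)) =
        φ 1 * gm k.1.1 (f x) (hm k) e := by
    intro k c hc
    induction hc using Submodule.span_induction with
    | mem c hc =>
      obtain ⟨a, ha, rfl⟩ := hc
      intro d
      have ha' : a ∈ I.ideal k.1 := ha
      rw [hI] at ha'
      obtain ⟨a', ha2, rfl⟩ := Ideal.mem_span_singleton_mul.mp ha'
      obtain ⟨w, hw⟩ := hφ k d
      refine ⟨a' * w, Ideal.mul_mem_right _ _ ha2, ?_⟩
      rw [mul_comm d, map_mul, gm_pb, hφσ, hw, map_mul, map_mul, gm_res, hsg, mul_assoc]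
    | zero =>
      intro d
      exact ⟨0, zero_mem _, by rw [mul_zero, map_zero, map_zero, map_zero, mul_zero]⟩
    | add c c' _ _ h h' =>
      intro d
      obtain ⟨e, he, h⟩ := h d
      obtain ⟨e', he', h'⟩ := h' d
      exact ⟨e + e', add_mem he he', by rw [mul_add, map_add, map_add, h, h', map_add, mul_add]⟩
    | smul a c _ h =>
      intro d
      obtain ⟨e, he, h⟩ := h (d * a)
      exact ⟨e, he, by rw [smul_eq_mul, ← mul_assoc, h]⟩
  choose e heJ he using fun k => hred k _ (hmem k) 1
  obtain ⟨R, hR⟩ := glue_stalk (fun k : S => k.1.1) hS (f x) hm (v * φ (gm ⊤ x trivial b))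
    (fun k => tk k + e k) (by
      intro k
      have h1 := he k
      rw [one_mul, map_sub] at h1
      replace h1 := (congrArg φ (congrArg₂ (fun p q => p - q)
        (gm_res (le_top : f ⁻¹ᵁ k.1.1 ≤ ⊤) x (hm k) b)
        (gm_pb f k.1.1 x (hm k) (tk k)))).symm.trans h1
      simp only [map_sub] at h1
      rw [← mul_one ((f.stalkMap x).hom _), hφσ] at h1
      rw [map_add]
      linear_combination (-(gm k.1.1 (f x) (hm k) (tk k)) - gm k.1.1 (f x) (hm k) (e k)) * hv
        - v * h1)
  refine ⟨R, eq_of_cover (VT T).subschemeι _ hS _ _ fun k => ?_⟩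
  rw [← gpb_res, hR, map_add, pb_eq_zero _ k.1 _ (heJ k), add_zero, ← ht']
  exact pb_lift _ _ _ einc _ _ _ (htk k)




lemma reduced_VT {Y : Scheme.{u}} (T : Closeds Y) : IsReduced (VT T).subscheme := by
  have : ∀ i, IsReduced ((VT T).subschemeCover.openCover.X i) := by
    intro U
    have h : _root_.IsReduced (Γ(Y, U.1) ⧸ (VT T).ideal U) := by
      rw [← Ideal.isRadical_iff_quotient_reduced]
      exact PrimeSpectrum.isRadical_vanishingIdeal _
    have h' : _root_.IsReduced (CommRingCat.of (Γ(Y, U.1) ⧸ (VT T).ideal U)) := h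
    exact (inferInstance : IsReduced (Spec (CommRingCat.of (Γ(Y, U.1) ⧸ (VT T).ideal U))))
  exact IsReduced.of_openCover _ (VT T).subschemeCover.openCover

lemma isNoetherian_of_closed {W Y : Scheme.{u}} (i : W ⟶ Y) [IsClosedImmersion i]
    [IsNoetherian Y] : IsNoetherian W :=
  { __ := LocallyOfFiniteType.isLocallyNoetherian i
    __ := QuasiCompact.compactSpace_of_compactSpace i }

lemma integral_closure {X : Scheme.{u}} (x : X) :
    IsIntegral (VT (Y := X) ⟨closure {x}, isClosed_closure⟩).subscheme := by
  set T : Closeds X := ⟨closure {x}, isClosed_closure⟩ with hT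
  have := reduced_VT T
  obtain ⟨z, hz⟩ : x ∈ Set.range (VT T).subschemeι := by
    rw [range_VT]; exact subset_closure rfl
  have hcl : closure {z} = (Set.univ : Set (VT T).subscheme) := by
    rw [Set.eq_univ_iff_forall]
    intro w
    rw [← specializes_iff_mem_closure,
      ← (VT T).subschemeι.isEmbedding.isInducing.specializes_iff, hz, specializes_iff_mem_closure]
    have : (VT T).subschemeι w ∈ Set.range (VT T).subschemeι := ⟨w, rfl⟩
    rw [range_VT] at this
    exact this
  have hirr : IsIrreducible (Set.univ : Set (VT T).subscheme) := by
    rw [← hcl]; exact isIrreducible_singleton.closure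
  have : IrreducibleSpace (VT T).subscheme :=
    { isPreirreducible_univ := hirr.2
      toNonempty := ⟨z⟩ }
  exact isIntegral_of_irreducibleSpace_of_isReduced _

theorem stepRed {X Y : Scheme.{u}} [IsNoetherian Y] [IsReduced Y] [IsAffine X]
    (f : X ⟶ Y) [IsFinite f] (hf : Function.Surjective f) (hcl : ProperAffine Y) : IsAffine Y := by
  rcases isEmpty_or_nonempty Y with hemp | hne
  · infer_instance
  refine critC Y hcl fun T hT => ?_
  by_cases hirr : IsPreirreducible (Set.univ : Set Y)
  · have : IrreducibleSpace Y :=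
      { isPreirreducible_univ := hirr
        toNonempty := hne }
    have : IsIntegral Y := isIntegral_of_irreducibleSpace_of_isReduced _
    obtain ⟨x, hx⟩ := hf (genericPoint Y)
    let Z : Closeds X := ⟨closure {x}, isClosed_closure⟩
    have : IsIntegral (VT Z).subscheme := integral_closure x
    have : IsAffine (VT Z).subscheme := isAffine_of_isAffineHom (VT Z).subschemeι
    refine ext_integral ((VT Z).subschemeι ≫ f) ?_ hcl T hT
    rw [← Set.range_eq_univ]
    have hclosed : IsClosed (Set.range ((VT Z).subschemeι ≫ f)) :=
      ((VT Z).subschemeι ≫ f).isClosedMap.isClosed_range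
    rw [← Set.univ_subset_iff, ← genericPoint_spec Y]
    refine closure_minimal ?_ hclosed
    obtain ⟨z, hz⟩ : x ∈ Set.range (VT Z).subschemeι := by
      rw [range_VT]; exact subset_closure rfl
    rw [Set.singleton_subset_iff]
    refine ⟨z, ?_⟩
    rw [Scheme.Hom.comp_apply, hz, hx]
  · rw [isPreirreducible_iff_isClosed_union_isClosed] at hirr
    push Not at hirr
    obtain ⟨A, B, hA, hB, hAB, hA', hB'⟩ := hirr
    refine ext_reducible hcl ⟨A, hA⟩ ⟨B, hB⟩ ?_ ?_ ?_ T
    · intro h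
      exact hA' (congrArg (fun Z : Closeds Y => (Z : Set Y)) h).ge
    · intro h
      exact hB' (congrArg (fun Z : Closeds Y => (Z : Set Y)) h).ge
    · apply SetLike.coe_injective
      exact Set.univ_subset_iff.mp hAB

lemma pullback_surj {X Y W : Scheme.{u}} (f : X ⟶ Y) (i : W ⟶ Y) (hf : Function.Surjective f) :
    Function.Surjective (Limits.pullback.snd f i) := by
  have : Surjective f := ⟨hf⟩
  exact (Limits.pullback.snd f i).surjective

theorem step {X Y : Scheme.{u}} [IsNoetherian Y] [IsAffine X]
    (f : X ⟶ Y) [IsFinite f] (hf : Function.Surjective f) (hcl : ProperAffine Y) : IsAffine Y := by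
  have hs : Function.Surjective (VT (⊤ : Closeds Y)).subschemeι := by
    rw [← Set.range_eq_univ, range_VT]; rfl
  have : IsAffine (VT (⊤ : Closeds Y)).subscheme := by
    have := reduced_VT (⊤ : Closeds Y)
    have := isNoetherian_of_closed (VT (⊤ : Closeds Y)).subschemeι
    have : IsAffine (Limits.pullback f (VT (⊤ : Closeds Y)).subschemeι) :=
      isAffine_of_isAffineHom (Limits.pullback.fst f (VT (⊤ : Closeds Y)).subschemeι)
    refine stepRed (Limits.pullback.snd f (VT (⊤ : Closeds Y)).subschemeι)
      (pullback_surj f _ hf) ?_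
    intro V j hj hnj
    refine hcl V (j ≫ (VT (⊤ : Closeds Y)).subschemeι) inferInstance fun hjs => hnj fun w => ?_
    obtain ⟨v, hv⟩ := hjs ((VT (⊤ : Closeds Y)).subschemeι w)
    exact ⟨v, (VT (⊤ : Closeds Y)).subschemeι.isEmbedding.injective hv⟩
  rw [VT, Scheme.IdealSheafData.vanishingIdeal_top] at this
  exact lemmaN Y

theorem main {X Y : Scheme.{u}} [IsNoetherian Y] [IsAffine X]
    (f : X ⟶ Y) [IsFinite f] (hf : Function.Surjective f) : IsAffine Y := by
  have key : ∀ Z : Closeds Y, ∀ (W : Scheme.{u}) (i : W ⟶ Y), IsClosedImmersion i →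
      Set.range i = Z → IsAffine W := by
    intro Z
    induction Z using WellFoundedLT.induction with
    | ind Z ih =>
    intro W i hi hr
    have := isNoetherian_of_closed i
    have : IsAffine (Limits.pullback f i) := isAffine_of_isAffineHom (Limits.pullback.fst f i)
    refine step (Limits.pullback.snd f i) (pullback_surj f _ hf) ?_
    intro V j hj hnj
    refine ih ⟨Set.range (j ≫ i), (j ≫ i).isClosedEmbedding.isClosed_range⟩ ?_ V (j ≫ i)
      inferInstance rfl
    rw [← SetLike.coe_ssubset_coe, ← hr]
    change Set.range (j ≫ i) ⊂ Set.range i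
    rw [Set.ssubset_iff_subset_ne]
    refine ⟨?_, fun he => hnj fun w => ?_⟩
    · rintro _ ⟨v, rfl⟩
      exact ⟨j v, (Scheme.Hom.comp_apply _ _ _).symm⟩
    · have : i w ∈ Set.range (j ≫ i) := by rw [he]; exact ⟨w, rfl⟩
      obtain ⟨v, hv⟩ := this
      rw [Scheme.Hom.comp_apply] at hv
      exact ⟨v, i.isEmbedding.injective hv⟩
  exact key ⊤ Y (𝟙 Y) inferInstance (by ext y; simp)


end Chev


open AlgebraicGeometry

/-- Chevalley's theorem: if `f : X → Y` is a finite surjective morphism of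
Noetherian schemes and `X` is affine, then `Y` is affine. -/
theorem stmt13 (X Y : Scheme) [IsNoetherian X] [IsNoetherian Y]
    (f : X ⟶ Y) [IsFinite f] [Surjective f] (hX : IsAffine X) :
    IsAffine Y := by
  have := hX
  exact Chev.main f f.surjective
end
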